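/- arXiv:2308.00314 — 5 statements merged into one kernel-verified Lean document; each statement's English description precedes it below -/
import Mathlib

section
/- Let R > 0, T > 0, let f, g : (0,∞) → ℝ be C^∞ and nondecreasing, and let (u,m) with u ∈ C²(ℝ × [0,T]), m ∈ C¹(ℝ × [0,T]), both R-periodic in x and m > 0, be a classical solution of −∂_t u + (1/2)(∂_x u)² = f(m), ∂_t m − ∂_x(m·∂_x u) = 0 on ℝ × [0,T] with terminal condition u(x,T) = g(m(x,T)) for all x. Assume m(·,0) is even and nonincreasing on [0, R/2], and assume (u,m) is the unique such solution: every pair (ũ, m̃) with the same regularity, periodicity, positivity, equations, terminal condition and m̃(·,0) = m(·,0) satisfies m̃ = m and ũ = u. Then: (i) for every t ∈ [0,T], m(·,t) is even and nonincreasing on [0, R/2]; (ii) if γ satisfies ∂_t γ(x,t) = −u_x(γ(x,t), t) and γ(x,0) = x with x ∈ [0, R/2], then t ↦ γ(x,t) is concave and nondecreasing on [0,T]; and (iii) u_x ≤ 0 on [0, R/2] × [0,T]. -/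
open Set

/-- Partial derivative in the first (space) variable. -/
noncomputable def pdx (u : ℝ → ℝ → ℝ) (x t : ℝ) : ℝ := deriv (fun y => u y t) x

/-- Partial derivative in the second (time) variable. -/
noncomputable def pdt (u : ℝ → ℝ → ℝ) (x t : ℝ) : ℝ := deriv (fun s => u x s) t

/-- `(u, m)` is a classical `R`-periodic solution, with `u ∈ C²`, `m ∈ C¹` and `m > 0`, of
the 1D MFG system with coupling `f` and terminal condition `u(·,T) = g(m(·,T))`. -/
def TermSol (R T : ℝ) (f g : ℝ → ℝ) (u m : ℝ → ℝ → ℝ) : Prop :=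
  ContDiffOn ℝ 2 (fun p : ℝ × ℝ => u p.1 p.2) {p : ℝ × ℝ | p.2 ∈ Set.Icc 0 T} ∧
  ContDiffOn ℝ 1 (fun p : ℝ × ℝ => m p.1 p.2) {p : ℝ × ℝ | p.2 ∈ Set.Icc 0 T} ∧
  (∀ x t : ℝ, u (x + R) t = u x t) ∧
  (∀ x t : ℝ, m (x + R) t = m x t) ∧
  (∀ x t : ℝ, t ∈ Set.Icc 0 T → 0 < m x t) ∧
  (∀ x t : ℝ, t ∈ Set.Icc 0 T →
    -pdt u x t + (1/2) * (pdx u x t)^2 = f (m x t)) ∧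
  (∀ x t : ℝ, t ∈ Set.Icc 0 T →
    pdt m x t - pdx (fun y s => m y s * pdx u y s) x t = 0) ∧
  (∀ x : ℝ, u x T = g (m x T))

open Filter Topology MeasureTheory

/-- A jointly continuous function of two variables is bounded on rectangles. -/
theorem exists_bound_rect {F : ℝ → ℝ → ℝ} (hF : Continuous (Function.uncurry F)) (a b c d : ℝ) :
    ∃ K, 0 ≤ K ∧ ∀ s ∈ uIcc a b, ∀ t ∈ Icc c d, |F s t| ≤ K := by
  obtain ⟨K, hK⟩ := ((isCompact_uIcc (a := a) (b := b)).prod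
    (isCompact_Icc (a := c) (b := d))).exists_bound_of_continuousOn hF.continuousOn
  refine ⟨max K 0, le_max_right _ _, fun s hs t ht => ?_⟩
  exact (hK (s, t) ⟨hs, ht⟩).trans (le_max_left _ _)

/-- Differentiation under the integral sign at a single point, from a Lipschitz bound there. -/
theorem hasDerivAt_integral_of_lip_at {F : ℝ → ℝ → ℝ} {F' : ℝ → ℝ} {a b t₀ K : ℝ}
    (hF : ∀ t, Continuous fun s => F s t) (hF' : Continuous F')
    (hlip : ∀ᶠ t in 𝓝 t₀, ∀ s ∈ uIcc a b, |F s t - F s t₀| ≤ K * |t - t₀|)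
    (hd : ∀ s ∈ uIcc a b, HasDerivAt (F s) (F' s) t₀) :
    HasDerivAt (fun t => ∫ s in a..b, F s t) (∫ s in a..b, F' s) t₀ := by
  have key := hasFDerivAt_integral_of_dominated_loc_of_lip' (𝕜 := ℝ)
    (μ := volume.restrict (uIoc a b)) (F := fun t s => F s t) (x₀ := t₀)
    (F' := fun s => ContinuousLinearMap.toSpanSingleton ℝ (F' s)) (bound := fun _ => K) hlip
    (fun t _ => (hF t).aestronglyMeasurable)
    (intervalIntegrable_iff.1 ((hF t₀).intervalIntegrable a b))
    (Continuous.aestronglyMeasurable (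
      (ContinuousLinearMap.toSpanSingletonCLE (𝕜 := ℝ) (E := ℝ)).continuous.comp hF'))
    ((ae_restrict_iff' measurableSet_uIoc).2 (ae_of_all _ fun s hs t ht => by
      simpa using ht s (uIoc_subset_uIcc hs)))
    (intervalIntegrable_iff.1 (continuous_const.intervalIntegrable a b))
    ((ae_restrict_iff' measurableSet_uIoc).2 (ae_of_all _ fun s hs =>
      (hd s (uIoc_subset_uIcc hs)).hasFDerivAt))
  have h2 := key.2.hasDerivAt
  rw [ContinuousLinearMap.integral_apply key.1] at h2
  simp only [ContinuousLinearMap.toSpanSingleton_apply, one_smul] at h2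
  simp only [intervalIntegral.intervalIntegral_eq_integral_uIoc]
  exact h2.fun_const_smul _

/-- A function with a jointly continuous time derivative is locally Lipschitz in time, uniformly
on bounded space intervals. -/
theorem eventually_lip_of_hasDerivAt {F F' : ℝ → ℝ → ℝ} {a b T t₀ : ℝ} (ht₀ : t₀ ∈ Ioo 0 T)
    (hF' : Continuous (Function.uncurry F'))
    (hd : ∀ s, ∀ t ∈ Ioo 0 T, HasDerivAt (F s) (F' s t) t) :
    ∃ K, ∀ᶠ t in 𝓝 t₀, ∀ s ∈ uIcc a b, |F s t - F s t₀| ≤ K * |t - t₀| := by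
  obtain ⟨K, -, hK⟩ := exists_bound_rect hF' a b 0 T
  refine ⟨K, ?_⟩
  filter_upwards [isOpen_Ioo.mem_nhds ht₀] with t ht s hs
  simpa using (convex_Ioo (0 : ℝ) T).norm_image_sub_le_of_norm_hasDerivWithin_le
    (fun x hx => (hd s x hx).hasDerivWithinAt)
    (fun x hx => by simpa using hK s hs x (Ioo_subset_Icc_self hx)) ht₀ ht

theorem hasDerivAt_integral_of_continuous {F F' : ℝ → ℝ → ℝ} {T t₀ : ℝ} (a b : ℝ)
    (ht₀ : t₀ ∈ Ioo 0 T) (hF : ∀ t, Continuous fun s => F s t)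
    (hF' : Continuous (Function.uncurry F'))
    (hd : ∀ s, ∀ t ∈ Ioo 0 T, HasDerivAt (F s) (F' s t) t) :
    HasDerivAt (fun t => ∫ s in a..b, F s t) (∫ s in a..b, F' s t₀) t₀ := by
  obtain ⟨K, hK⟩ := eventually_lip_of_hasDerivAt (a := a) (b := b) ht₀ hF' hd
  exact hasDerivAt_integral_of_lip_at hF (by fun_prop) hK fun s _ => hd s t₀ ht₀

/-- Time derivative of `∫ Y_s P` when `P` vanishes at the endpoints; no mixed derivatives of `Y`
or `P` are needed. -/
theorem hasDerivAt_integral_deriv_mul {Y Ys Yt P Ps Pt : ℝ → ℝ → ℝ} {a b T t₀ : ℝ}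
    (ht₀ : t₀ ∈ Ioo 0 T)
    (cY : Continuous (Function.uncurry Y)) (cYs : Continuous (Function.uncurry Ys))
    (cYt : Continuous (Function.uncurry Yt)) (cP : Continuous (Function.uncurry P))
    (cPs : Continuous (Function.uncurry Ps)) (cPt : Continuous (Function.uncurry Pt))
    (hYs : ∀ s t, HasDerivAt (fun σ => Y σ t) (Ys s t) s)
    (hYt : ∀ s, ∀ t ∈ Ioo 0 T, HasDerivAt (Y s) (Yt s t) t)
    (hPs : ∀ s t, HasDerivAt (fun σ => P σ t) (Ps s t) s)
    (hPt : ∀ s, ∀ t ∈ Ioo 0 T, HasDerivAt (P s) (Pt s t) t)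
    (ha : ∀ t, P a t = 0) (hb : ∀ t, P b t = 0) :
    HasDerivAt (fun t => ∫ s in a..b, Ys s t * P s t)
      (∫ s in a..b, (Ys s t₀ * Pt s t₀ - Yt s t₀ * Ps s t₀)) t₀ := by
  obtain ⟨K, hK⟩ := eventually_lip_of_hasDerivAt (a := a) (b := b) ht₀ cPt hPt
  obtain ⟨L, hL0, hL⟩ := exists_bound_rect cYs a b 0 T
  have h1 : HasDerivAt (fun t => ∫ s in a..b, Ys s t * (P s t - P s t₀))
      (∫ s in a..b, Ys s t₀ * Pt s t₀) t₀ := by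
    refine hasDerivAt_integral_of_lip_at (K := L * K) (fun t => by fun_prop) (by fun_prop) ?_ ?_
    · filter_upwards [hK, isOpen_Ioo.mem_nhds ht₀] with t ht htT s hs
      rw [sub_self, mul_zero, sub_zero, abs_mul, mul_assoc]
      exact mul_le_mul (hL s hs t (Ioo_subset_Icc_self htT)) (ht s hs) (abs_nonneg _) hL0
    · intro s _
      have hc : ContinuousAt (fun t => Ys s t) t₀ := by fun_prop
      have hd := hPt s t₀ ht₀
      rw [hasDerivAt_iff_tendsto_slope] at hd ⊢
      refine ((hc.tendsto.mono_left nhdsWithin_le_nhds).mul hd).congr fun t => ?_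
      simp only [slope_def_field]
      ring
  have h2 : HasDerivAt (fun t => -∫ s in a..b, Y s t * Ps s t₀)
      (-∫ s in a..b, Yt s t₀ * Ps s t₀) t₀ := by
    refine (hasDerivAt_integral_of_continuous (F := fun s t => Y s t * Ps s t₀)
      (F' := fun s t => Yt s t * Ps s t₀) a b ht₀ (fun t => by fun_prop) (by fun_prop) ?_).neg
    exact fun s t ht => (hYt s t ht).mul_const _
  have h3 := h1.add h2
  rw [intervalIntegral.integral_sub (Continuous.intervalIntegrable (by fun_prop) _ _)
    (Continuous.intervalIntegrable (by fun_prop) _ _), sub_eq_add_neg]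
  refine h3.congr_of_eventuallyEq (Eventually.of_forall fun t => ?_)
  have hibp := intervalIntegral.integral_mul_deriv_eq_deriv_mul (a := a) (b := b)
    (u := fun s => Y s t) (u' := fun s => Ys s t) (v := fun s => P s t₀) (v' := fun s => Ps s t₀)
    (fun s _ => hYs s t) (fun s _ => hPs s t₀)
    (Continuous.intervalIntegrable (by fun_prop) _ _)
    (Continuous.intervalIntegrable (by fun_prop) _ _)
  simp only [ha, hb, mul_zero, sub_zero, zero_sub] at hibp
  simp only [Pi.add_apply, hibp, neg_neg]
  rw [← intervalIntegral.integral_add (Continuous.intervalIntegrable (by fun_prop) _ _)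
    (Continuous.intervalIntegrable (by fun_prop) _ _)]
  refine intervalIntegral.integral_congr fun s _ => ?_
  ring

/-- A `C²` convex approximation of the negative part `z ↦ max (-z) 0`. -/
noncomputable def smoothNeg (ε z : ℝ) : ℝ := (max (-z) 0) ^ 3 / (max (-z) 0 + ε) ^ 2

/-- The derivative of `smoothNeg`. -/
noncomputable def smoothNegD (ε z : ℝ) : ℝ :=
  -((max (-z) 0) ^ 2 * (max (-z) 0 + 3 * ε) / (max (-z) 0 + ε) ^ 3)

/-- The second derivative of `smoothNeg`. -/
noncomputable def smoothNegDD (ε z : ℝ) : ℝ := 6 * max (-z) 0 * ε ^ 2 / (max (-z) 0 + ε) ^ 4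

/-- Composition with the negative part preserves differentiability for functions with a critical
point at zero. -/
theorem hasDerivAt_comp_negPart {h h' : ℝ → ℝ} (hd : ∀ x, 0 ≤ x → HasDerivAt h (h' x) x)
    (h0 : h' 0 = 0) (z : ℝ) :
    HasDerivAt (fun z => h (max (-z) 0)) (-h' (max (-z) 0)) z := by
  rcases lt_trichotomy z 0 with hz | rfl | hz
  · have : HasDerivAt (fun z => h (-z)) (-h' (-z)) z := by
      simpa using! (hd (-z) (by linarith)).scomp z (hasDerivAt_neg z)
    rw [max_eq_left (by linarith : (0 : ℝ) ≤ -z)]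
    refine this.congr_of_eventuallyEq ?_
    filter_upwards [Iio_mem_nhds hz] with y hy
    rw [max_eq_left (by simp only [mem_Iio] at hy; linarith : (0 : ℝ) ≤ -y)]
  · have h1 : HasDerivAt (fun z => h (-z)) 0 0 := by
      simpa [h0] using! (hd (-0) (by simp)).scomp 0 (hasDerivAt_neg 0)
    have h2 : HasDerivWithinAt (fun z => h (max (-z) 0)) 0 (Iic 0) 0 :=
      h1.hasDerivWithinAt.congr (fun y hy => by
        rw [max_eq_left (by simp only [mem_Iic] at hy; linarith : (0 : ℝ) ≤ -y)]) (by simp)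
    have h3 : HasDerivWithinAt (fun z => h (max (-z) 0)) 0 (Ici 0) 0 :=
      (hasDerivWithinAt_const 0 (Ici 0) (h 0)).congr (fun y hy => by
        rw [max_eq_right (by simp only [mem_Ici] at hy; linarith : -y ≤ (0 : ℝ))]) (by simp)
    have h4 := h2.union h3
    rw [Iic_union_Ici, hasDerivWithinAt_univ] at h4
    simpa [h0] using h4
  · rw [max_eq_right (by linarith : -z ≤ (0 : ℝ)), h0, neg_zero]
    refine (hasDerivAt_const z (h 0)).congr_of_eventuallyEq ?_
    filter_upwards [Ioi_mem_nhds hz] with y hy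
    rw [max_eq_right (by simp only [mem_Ioi] at hy; linarith : -y ≤ (0 : ℝ))]

theorem hasDerivAt_smoothNeg {ε : ℝ} (hε : 0 < ε) (z : ℝ) :
    HasDerivAt (smoothNeg ε) (smoothNegD ε z) z := by
  refine hasDerivAt_comp_negPart (h := fun x => x ^ 3 / (x + ε) ^ 2)
    (h' := fun x => x ^ 2 * (x + 3 * ε) / (x + ε) ^ 3) (fun x hx => ?_) (by simp) z
  have hne : x + ε ≠ 0 := by positivity
  refine ((hasDerivAt_pow 3 x).div (((hasDerivAt_id x).add_const ε).pow 2)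
    (pow_ne_zero 2 hne)).congr_deriv ?_
  simp only [id, Pi.pow_apply]
  field_simp
  push_cast
  ring

theorem hasDerivAt_smoothNegD {ε : ℝ} (hε : 0 < ε) (z : ℝ) :
    HasDerivAt (smoothNegD ε) (smoothNegDD ε z) z := by
  have := (hasDerivAt_comp_negPart (h := fun x => x ^ 2 * (x + 3 * ε) / (x + ε) ^ 3)
    (h' := fun x => 6 * x * ε ^ 2 / (x + ε) ^ 4) (fun x hx => ?_) (by simp) z).neg
  · rw [neg_neg] at this
    exact this
  have hne : x + ε ≠ 0 := by positivity
  refine (((hasDerivAt_pow 2 x).mul ((hasDerivAt_id x).add_const (3 * ε))).div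
    (((hasDerivAt_id x).add_const ε).pow 3) (pow_ne_zero 3 hne)).congr_deriv ?_
  simp only [id, Pi.pow_apply, Pi.mul_apply]
  field_simp
  push_cast
  ring

theorem continuous_smoothNegDD {ε : ℝ} (hε : 0 < ε) : Continuous (smoothNegDD ε) := by
  unfold smoothNegDD
  refine Continuous.div (by fun_prop) (by fun_prop) fun z => ?_
  have := le_max_right (-z) 0
  positivity

theorem smoothNegDD_nonneg {ε : ℝ} (hε : 0 < ε) (z : ℝ) : 0 ≤ smoothNegDD ε z := by
  have := le_max_right (-z) 0
  unfold smoothNegDD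
  positivity

theorem negPart_sub_le_smoothNeg {ε : ℝ} (hε : 0 < ε) (z : ℝ) :
    max (-z) 0 - 2 * ε ≤ smoothNeg ε z := by
  have h := le_max_right (-z) 0
  unfold smoothNeg
  set ζ := max (-z) 0
  rw [le_div_iff₀ (by positivity)]
  have : 0 ≤ ε ^ 2 * ζ + ε ^ 3 := by positivity
  nlinarith

theorem smoothNegDD_mul_abs_le {ε : ℝ} (hε : 0 < ε) (z : ℝ) : smoothNegDD ε z * |z| ≤ 1 := by
  unfold smoothNegDD
  rcases le_total 0 z with hz | hz
  · rw [max_eq_right (by linarith)]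
    simp
  · have hpos : 0 < -z + ε := by linarith
    rw [max_eq_left (by linarith), abs_of_nonpos hz, div_mul_eq_mul_div, div_le_one (by positivity)]
    generalize hx : -z = x
    have hx0 : 0 ≤ x := by linarith
    have h1 : 0 ≤ x * ε := by positivity
    have h2 : 0 ≤ x * ε * (x ^ 2 + ε ^ 2) := by positivity
    nlinarith [sq_nonneg (x ^ 2), sq_nonneg (ε ^ 2)]

theorem tendsto_smoothNegDD_mul_abs (z : ℝ) :
    Tendsto (fun ε => smoothNegDD ε z * |z|) (𝓝[>] 0) (𝓝 0) := by
  unfold smoothNegDD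
  rcases le_or_gt 0 z with hz | hz
  · rw [max_eq_right (by linarith)]
    simp
  · rw [max_eq_left (by linarith)]
    have : ContinuousAt (fun ε : ℝ => 6 * -z * ε ^ 2 / (-z + ε) ^ 4 * |z|) 0 := by
      have h0 : (-z + 0) ^ 4 ≠ 0 := pow_ne_zero _ (by linarith)
      fun_prop (disch := assumption)
    have h := this.tendsto.mono_left (nhdsWithin_le_nhds (s := Ioi 0))
    simpa using h

theorem smoothNeg_of_nonneg {z : ℝ} (ε : ℝ) (hz : 0 ≤ z) : smoothNeg ε z = 0 := by
  unfold smoothNeg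
  rw [max_eq_right (by linarith)]
  simp

theorem smoothNegD_of_nonneg {z : ℝ} (ε : ℝ) (hz : 0 ≤ z) : smoothNegD ε z = 0 := by
  unfold smoothNegD
  rw [max_eq_right (by linarith)]
  simp

/-- **Minimum principle for a degenerate elliptic first-order system.** Here `Z_t = -Y_s` while
`Y_t Z_s` is nonnegative and `Y(·, T) Z_s(·, T)` is nonpositive, both up to an error controlled by
`|Z|`. -/
theorem nonneg_of_degenerate_elliptic {Z Zs Y Ys Yt : ℝ → ℝ → ℝ} {a b T C : ℝ}
    (hab : a ≤ b) (hT : 0 < T) (hC : 0 ≤ C)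
    (cZ : Continuous (Function.uncurry Z)) (cZs : Continuous (Function.uncurry Zs))
    (cY : Continuous (Function.uncurry Y)) (cYs : Continuous (Function.uncurry Ys))
    (cYt : Continuous (Function.uncurry Yt))
    (hZs : ∀ s t, HasDerivAt (fun σ => Z σ t) (Zs s t) s)
    (hYs : ∀ s t, HasDerivAt (fun σ => Y σ t) (Ys s t) s)
    (hZt : ∀ s, ∀ t ∈ Ioo 0 T, HasDerivAt (Z s) (-Ys s t) t)
    (hYt : ∀ s, ∀ t ∈ Ioo 0 T, HasDerivAt (Y s) (Yt s t) t)
    (ha : ∀ t, Z a t = 0) (hb : ∀ t, Z b t = 0)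
    (h0 : ∀ s ∈ Icc a b, 0 ≤ Z s 0)
    (hell : ∀ s ∈ Icc a b, ∀ t ∈ Ioo 0 T, -(C * |Z s t|) ≤ Yt s t * Zs s t)
    (hend : ∀ s ∈ Icc a b, Y s T * Zs s T ≤ C * |Z s T|) :
    ∀ s ∈ Icc a b, ∀ t ∈ Icc 0 T, 0 ≤ Z s t := by
  set D : ℝ → ℝ → ℝ := fun ε t => ∫ s in a..b, smoothNegDD ε (Z s t) * |Z s t| with hD
  have cD : ∀ ε, 0 < ε → Continuous (D ε) := fun ε hε => by
    have := continuous_smoothNegDD hε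
    refine intervalIntegral.continuous_parametric_intervalIntegral_of_continuous'
      (f := fun t s => smoothNegDD ε (Z s t) * |Z s t|) ?_ a b
    fun_prop
  have hD0 : ∀ ε, 0 < ε → ∀ t, 0 ≤ D ε t := fun ε hε t =>
    intervalIntegral.integral_nonneg hab fun s _ =>
      mul_nonneg (smoothNegDD_nonneg hε _) (abs_nonneg _)
  have hD1 : ∀ ε, 0 < ε → ∀ t, D ε t ≤ b - a := fun ε hε t => by
    have := continuous_smoothNegDD hε
    have h := intervalIntegral.integral_mono_on (μ := volume) hab
      (f := fun s => smoothNegDD ε (Z s t) * |Z s t|) (g := fun _ => (1 : ℝ))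
      (Continuous.intervalIntegrable (by fun_prop) _ _)
      (Continuous.intervalIntegrable (by fun_prop) _ _) (fun s _ => smoothNegDD_mul_abs_le hε _)
    simpa using h
  have hDlim : ∀ t, Tendsto (fun ε => D ε t) (𝓝[>] 0) (𝓝 0) := fun t => by
    have h := intervalIntegral.tendsto_integral_filter_of_dominated_convergence (a := a) (b := b)
      (μ := volume) (l := 𝓝[>] (0 : ℝ)) (F := fun ε s => smoothNegDD ε (Z s t) * |Z s t|)
      (f := fun _ => 0) (fun _ => 1) ?_ ?_ (continuous_const.intervalIntegrable _ _) ?_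
    · simpa using h
    · filter_upwards [self_mem_nhdsWithin] with ε hε
      have := continuous_smoothNegDD hε
      exact Continuous.aestronglyMeasurable (by fun_prop)
    · filter_upwards [self_mem_nhdsWithin] with ε hε
      refine ae_of_all _ fun s _ => ?_
      rw [Real.norm_of_nonneg (mul_nonneg (smoothNegDD_nonneg hε _) (abs_nonneg _))]
      exact smoothNegDD_mul_abs_le hε _
    · exact ae_of_all _ fun s _ => tendsto_smoothNegDD_mul_abs _
  have hIlim : Tendsto (fun ε => ∫ t in (0 : ℝ)..T, D ε t) (𝓝[>] 0) (𝓝 0) := by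
    have h := intervalIntegral.tendsto_integral_filter_of_dominated_convergence (a := 0) (b := T)
      (μ := volume) (l := 𝓝[>] (0 : ℝ)) (F := D)
      (f := fun _ => 0) (fun _ => b - a) ?_ ?_ (continuous_const.intervalIntegrable _ _) ?_
    · simpa using h
    · filter_upwards [self_mem_nhdsWithin] with ε hε
      exact (cD ε hε).aestronglyMeasurable
    · filter_upwards [self_mem_nhdsWithin] with ε hε
      refine ae_of_all _ fun s _ => ?_
      rw [Real.norm_of_nonneg (hD0 ε hε _)]
      exact hD1 ε hε _
    · exact ae_of_all _ fun t _ => hDlim t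
  have key : ∀ ε, 0 < ε → ∀ t ∈ Icc 0 T, ∫ s in a..b, smoothNeg ε (Z s t) ≤
      T * (C * (D ε T + ∫ t in (0 : ℝ)..T, D ε t)) := by
    intro ε hε
    have d0 := hasDerivAt_smoothNeg hε
    have d1 := hasDerivAt_smoothNegD hε
    have c0 : Continuous (smoothNeg ε) := continuous_iff_continuousAt.2 fun z => (d0 z).continuousAt
    have c1 : Continuous (smoothNegD ε) :=
      continuous_iff_continuousAt.2 fun z => (d1 z).continuousAt
    have c2 := continuous_smoothNegDD hε
    set B : ℝ → ℝ := fun t => ∫ s in a..b, Ys s t * smoothNegD ε (Z s t) with hB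
    have cB : Continuous B :=
      intervalIntegral.continuous_parametric_intervalIntegral_of_continuous'
        (f := fun t s => Ys s t * smoothNegD ε (Z s t)) (by fun_prop) a b
    have hB' : ∀ t ∈ Ioo 0 T, ∃ B', HasDerivAt B B' t ∧ B' ≤ C * D ε t := by
      intro t ht
      refine ⟨_, hasDerivAt_integral_deriv_mul (Y := Y) (Ys := Ys) (Yt := Yt)
        (P := fun s t => smoothNegD ε (Z s t))
        (Ps := fun s t => smoothNegDD ε (Z s t) * Zs s t)
        (Pt := fun s t => smoothNegDD ε (Z s t) * -Ys s t) ht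
        cY cYs cYt (by fun_prop) (by fun_prop) (by fun_prop) hYs hYt
        (fun s t => HasDerivAt.comp (h₂ := smoothNegD ε) s (d1 (Z s t)) (hZs s t))
        (fun s t ht => (d1 (Z s t)).comp t (hZt s t ht))
        (fun t => by rw [ha, smoothNegD_of_nonneg _ le_rfl])
        (fun t => by rw [hb, smoothNegD_of_nonneg _ le_rfl]), ?_⟩
      rw [hD, ← intervalIntegral.integral_const_mul]
      refine intervalIntegral.integral_mono_on hab
        (Continuous.intervalIntegrable (by fun_prop) _ _)
        (Continuous.intervalIntegrable (by fun_prop) _ _) fun s hs => ?_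
      have h1 := hell s hs t ht
      have h2 := smoothNegDD_nonneg hε (Z s t)
      nlinarith [mul_le_mul_of_nonneg_left h1 h2, mul_nonneg h2 (sq_nonneg (Ys s t))]
    have hBT : -(C * D ε T) ≤ B T := by
      have hibp := intervalIntegral.integral_mul_deriv_eq_deriv_mul (a := a) (b := b)
        (u := fun s => Y s T) (u' := fun s => Ys s T) (v := fun s => smoothNegD ε (Z s T))
        (v' := fun s => smoothNegDD ε (Z s T) * Zs s T)
        (fun s _ => hYs s T) (fun s _ => HasDerivAt.comp (h₂ := smoothNegD ε) s (d1 (Z s T)) (hZs s T))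
        (Continuous.intervalIntegrable (by fun_prop) _ _)
        (Continuous.intervalIntegrable (by fun_prop) _ _)
      simp only [ha, hb, smoothNegD_of_nonneg ε le_rfl, mul_zero, sub_zero, zero_sub] at hibp
      have h3 : ∫ s in a..b, Y s T * (smoothNegDD ε (Z s T) * Zs s T) ≤ C * D ε T := by
        rw [hD, ← intervalIntegral.integral_const_mul]
        refine intervalIntegral.integral_mono_on hab
          (Continuous.intervalIntegrable (by fun_prop) _ _)
          (Continuous.intervalIntegrable (by fun_prop) _ _) fun s hs => ?_
        have h1 := hend s hs
        have h2 := smoothNegDD_nonneg hε (Z s T)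
        nlinarith [mul_le_mul_of_nonneg_left h1 h2]
      rw [hibp] at h3
      linarith
    have hBlow : ∀ t ∈ Icc 0 T, -(C * (D ε T + ∫ t in (0 : ℝ)..T, D ε t)) ≤ B t := by
      have hanti : AntitoneOn (fun t => B t - C * ∫ τ in (0 : ℝ)..t, D ε τ) (Icc 0 T) := by
        have hder : ∀ t ∈ Ioo 0 T, ∃ e, HasDerivAt (fun t => B t - C * ∫ τ in (0 : ℝ)..t, D ε τ) e t
            ∧ e ≤ 0 := by
          intro t ht
          obtain ⟨B', hB1, hB2⟩ := hB' t ht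
          exact ⟨_, hB1.sub (((cD ε hε).integral_hasStrictDerivAt 0 t).hasDerivAt.const_mul C),
            by linarith⟩
        refine antitoneOn_of_deriv_nonpos (convex_Icc 0 T) ?_ ?_ ?_
        · have := intervalIntegral.continuous_primitive
            (fun a b => (cD ε hε).intervalIntegrable (μ := volume) a b) 0
          exact Continuous.continuousOn (by fun_prop)
        · rw [interior_Icc]
          intro t ht
          obtain ⟨e, he, -⟩ := hder t ht
          exact he.differentiableAt.differentiableWithinAt
        · rw [interior_Icc]
          intro t ht
          obtain ⟨e, he, he0⟩ := hder t ht
          rwa [he.deriv]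
      intro t ht
      have h1 := hanti ht (right_mem_Icc.2 hT.le) ht.2
      have h2 : 0 ≤ ∫ τ in (0 : ℝ)..t, D ε τ :=
        intervalIntegral.integral_nonneg ht.1 fun τ _ => hD0 ε hε τ
      simp only at h1
      nlinarith [mul_nonneg hC h2]
    have hA' : ∀ t ∈ Ioo 0 T, HasDerivAt (fun t => ∫ s in a..b, smoothNeg ε (Z s t)) (-B t) t := by
      intro t ht
      have := hasDerivAt_integral_of_continuous (F := fun s t => smoothNeg ε (Z s t))
        (F' := fun s t => smoothNegD ε (Z s t) * -Ys s t) a b ht (fun t => by fun_prop)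
        (by fun_prop) (fun s t ht => (d0 (Z s t)).comp t (hZt s t ht))
      refine this.congr_deriv ?_
      rw [hB, ← intervalIntegral.integral_neg]
      refine intervalIntegral.integral_congr fun s _ => ?_
      ring
    have hA0 : ∫ s in a..b, smoothNeg ε (Z s 0) = 0 := by
      rw [intervalIntegral.integral_congr (g := fun _ => (0 : ℝ))]
      · simp
      · intro s hs
        rw [uIcc_of_le hab] at hs
        exact smoothNeg_of_nonneg ε (h0 s hs)
    intro t ht
    have hδ : 0 ≤ C * (D ε T + ∫ t in (0 : ℝ)..T, D ε t) :=
      mul_nonneg hC (add_nonneg (hD0 ε hε T)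
        (intervalIntegral.integral_nonneg hT.le fun τ _ => hD0 ε hε τ))
    have cA : Continuous fun t => ∫ s in a..b, smoothNeg ε (Z s t) :=
      intervalIntegral.continuous_parametric_intervalIntegral_of_continuous'
        (f := fun t s => smoothNeg ε (Z s t)) (by fun_prop) a b
    have hmv := (convex_Icc 0 T).image_sub_le_mul_sub_of_deriv_le cA.continuousOn
      (fun τ hτ => by
        rw [interior_Icc] at hτ
        exact (hA' τ hτ).differentiableAt.differentiableWithinAt)
      (C := C * (D ε T + ∫ t in (0 : ℝ)..T, D ε t)) (fun τ hτ => by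
        rw [interior_Icc] at hτ
        rw [(hA' τ hτ).deriv]
        linarith [hBlow τ (Ioo_subset_Icc_self hτ)])
      0 (left_mem_Icc.2 hT.le) t ht ht.1
    rw [hA0] at hmv
    nlinarith [ht.2]
  intro s hs t ht
  by_contra! hneg
  have hint : ∫ s in a..b, max (-Z s t) 0 ≤ 0 := by
    have hlim : Tendsto (fun ε => T * (C * (D ε T + ∫ t in (0 : ℝ)..T, D ε t)) + 2 * ε * (b - a))
        (𝓝[>] 0) (𝓝 0) := by
      have hid : Tendsto (fun ε : ℝ => ε) (𝓝[>] 0) (𝓝 0) := nhdsWithin_le_nhds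
      simpa using ((((hDlim T).add hIlim).const_mul C).const_mul T).add
        ((hid.const_mul 2).mul_const (b - a))
    refine ge_of_tendsto hlim ?_
    filter_upwards [self_mem_nhdsWithin] with ε hε
    have c0 : Continuous (smoothNeg ε) :=
      continuous_iff_continuousAt.2 fun z => (hasDerivAt_smoothNeg hε z).continuousAt
    have h1 := intervalIntegral.integral_mono_on (μ := volume) hab
      (f := fun s => max (-Z s t) 0) (g := fun s => smoothNeg ε (Z s t) + 2 * ε)
      (Continuous.intervalIntegrable (by fun_prop) _ _)
      (Continuous.intervalIntegrable (by fun_prop) _ _)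
      (fun s _ => by linarith [negPart_sub_le_smoothNeg hε (Z s t)])
    rw [intervalIntegral.integral_add (Continuous.intervalIntegrable (by fun_prop) _ _)
      (Continuous.intervalIntegrable (by fun_prop) _ _), intervalIntegral.integral_const,
      smul_eq_mul] at h1
    linarith [key ε hε t ht]
  rcases hab.eq_or_lt with rfl | hlt
  · rw [le_antisymm hs.2 hs.1, ha] at hneg
    exact lt_irrefl _ hneg
  · refine absurd hint (not_le.2 ?_)
    exact intervalIntegral.integral_pos hlt (Continuous.continuousOn (by fun_prop))
      (fun _ _ => le_max_right _ _) ⟨s, hs, lt_max_of_lt_left (by linarith)⟩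

/-- Joint differentiability from continuous partial derivatives on a strip. -/
theorem hasFDerivAt_uncurry_of_partial {F Fx Ft : ℝ → ℝ → ℝ} {T x t : ℝ} (ht : t ∈ Ioo 0 T)
    (cFx : Continuous (Function.uncurry Fx)) (cFt : Continuous (Function.uncurry Ft))
    (hFx : ∀ x t, HasDerivAt (fun y => F y t) (Fx x t) x)
    (hFt : ∀ x, ∀ t ∈ Ioo 0 T, HasDerivAt (F x) (Ft x t) t) :
    HasFDerivAt (Function.uncurry F)
      (Fx x t • ContinuousLinearMap.fst ℝ ℝ ℝ + Ft x t • ContinuousLinearMap.snd ℝ ℝ ℝ)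
      (x, t) := by
  have c1 : ContinuousAt
      (Function.uncurry fun x t => ContinuousLinearMap.toSpanSingleton ℝ (Fx x t)) (x, t) :=
    ((ContinuousLinearMap.toSpanSingletonCLE (𝕜 := ℝ) (E := ℝ)).continuous.comp cFx).continuousAt
  have c2 : ContinuousAt
      (Function.uncurry fun x t => ContinuousLinearMap.toSpanSingleton ℝ (Ft x t)) (x, t) :=
    ((ContinuousLinearMap.toSpanSingletonCLE (𝕜 := ℝ) (E := ℝ)).continuous.comp cFt).continuousAt
  have h := (hasStrictFDerivAt_uncurry_coprod (𝕜 := ℝ) (u := (x, t)) (f := F)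
    (f₁ := fun x t => ContinuousLinearMap.toSpanSingleton ℝ (Fx x t))
    (f₂ := fun x t => ContinuousLinearMap.toSpanSingleton ℝ (Ft x t))
    (Eventually.of_forall fun p => (hFx p.1 p.2).hasFDerivAt)
    (by
      filter_upwards [(isOpen_Ioo.preimage continuous_snd).mem_nhds ht] with p hp
      exact (hFt p.1 p.2 hp).hasFDerivAt) c1 c2).hasFDerivAt
  refine HasFDerivAt.congr_fderiv h ?_
  ext <;> simp [Function.HasUncurry.uncurry]

/-- Chain rule for a function on a strip along a curve parametrized by time. -/
theorem hasDerivAt_along_curve {F Fx Ft : ℝ → ℝ → ℝ} {T t c' : ℝ} {c : ℝ → ℝ} (ht : t ∈ Ioo 0 T)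
    (cFx : Continuous (Function.uncurry Fx)) (cFt : Continuous (Function.uncurry Ft))
    (hFx : ∀ x t, HasDerivAt (fun y => F y t) (Fx x t) x)
    (hFt : ∀ x, ∀ t ∈ Ioo 0 T, HasDerivAt (F x) (Ft x t) t) (hc : HasDerivAt c c' t) :
    HasDerivAt (fun τ => F (c τ) τ) (Fx (c t) t * c' + Ft (c t) t) t := by
  have h1 : HasDerivAt (fun τ => (c τ, τ)) (c', (1 : ℝ)) t := hc.prodMk (hasDerivAt_id t)
  have h2 := HasFDerivAt.comp_hasDerivAt (f := fun τ => (c τ, τ)) t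
    (hasFDerivAt_uncurry_of_partial ht cFx cFt hFx hFt) h1
  refine h2.congr_deriv ?_
  simp

/-- The system satisfied by the density `m` and the momentum `v = u_x`, with time frozen outside
`[0, T]`. -/
structure DensityMomentum (R T : ℝ) (f g : ℝ → ℝ) (m mx v vx : ℝ → ℝ → ℝ) : Prop where
  cm : Continuous (Function.uncurry m)
  cmx : Continuous (Function.uncurry mx)
  cv : Continuous (Function.uncurry v)
  cvx : Continuous (Function.uncurry vx)
  pos : ∀ x t, 0 < m x t
  hmx : ∀ x t, HasDerivAt (fun y => m y t) (mx x t) x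
  hvx : ∀ x t, HasDerivAt (fun y => v y t) (vx x t) x
  hmt : ∀ x, ∀ t ∈ Ioo 0 T, HasDerivAt (m x) (mx x t * v x t + m x t * vx x t) t
  hvt : ∀ x, ∀ t ∈ Ioo 0 T, HasDerivAt (v x) (v x t * vx x t - deriv f (m x t) * mx x t) t
  term : ∀ x, v x T = deriv g (m x T) * mx x T
  even : ∀ x t, m (-x) t = m x t
  odd : ∀ x t, v (-x) t = -v x t
  m_per : ∀ x t, m (x + R) t = m x t
  v_per : ∀ x t, v (x + R) t = v x t
  clamp : ∀ x t, m x t = m x (max 0 (min t T))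

/-- The mass carried by the density `m` between `0` and `y`. -/
noncomputable def massTo (m : ℝ → ℝ → ℝ) (y t : ℝ) : ℝ := ∫ x in (0 : ℝ)..y, m x t

/-- The position at which the mass `s` is reached. -/
noncomputable def massPos (m : ℝ → ℝ → ℝ) (s t : ℝ) : ℝ :=
  Function.invFun (fun y => massTo m y t) s

namespace DensityMomentum

variable {R T : ℝ} {f g : ℝ → ℝ} {m mx v vx : ℝ → ℝ → ℝ}

theorem exists_bounds (h : DensityMomentum R T f g m mx v vx) (hR : 0 < R) :
    ∃ μ M, 0 < μ ∧ μ ≤ M ∧ ∀ x t, m x t ∈ Icc μ M := by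
  have hne : (Icc (0 : ℝ) R ×ˢ Icc 0 (max 0 T)).Nonempty :=
    ⟨(0, 0), ⟨le_rfl, hR.le⟩, ⟨le_rfl, le_max_left _ _⟩⟩
  have hcpt : IsCompact (Icc (0 : ℝ) R ×ˢ Icc 0 (max 0 T)) := isCompact_Icc.prod isCompact_Icc
  obtain ⟨p, -, hp⟩ := hcpt.exists_isMinOn hne h.cm.continuousOn
  obtain ⟨q, -, hq⟩ := hcpt.exists_isMaxOn hne h.cm.continuousOn
  have hmem : ∀ x t, m x t ∈ Icc (m p.1 p.2) (m q.1 q.2) := by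
    intro x t
    have hper : Function.Periodic (fun y => m y (max 0 (min t T))) R := fun y => h.m_per y _
    obtain ⟨y, hy, hxy⟩ := hper.exists_mem_Ico₀ hR x
    have hmem : (y, max 0 (min t T)) ∈ Icc (0 : ℝ) R ×ˢ Icc 0 (max 0 T) :=
      ⟨Ico_subset_Icc_self hy, le_max_left _ _, max_le_max le_rfl (min_le_right _ _)⟩
    rw [h.clamp x t]
    rw [hxy]
    exact ⟨hp hmem, hq hmem⟩
  exact ⟨_, _, h.pos _ _, (hmem 0 0).1.trans (hmem 0 0).2, hmem⟩

theorem v_zero (h : DensityMomentum R T f g m mx v vx) (t : ℝ) : v 0 t = 0 := by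
  have := h.odd 0 t
  rw [neg_zero] at this
  linarith

theorem v_half (h : DensityMomentum R T f g m mx v vx) (t : ℝ) : v (R / 2) t = 0 := by
  have h1 := h.odd (R / 2) t
  have h2 := h.v_per (-(R / 2)) t
  rw [show -(R / 2) + R = R / 2 by ring] at h2
  linarith

theorem m_reflect (h : DensityMomentum R T f g m mx v vx) (x t : ℝ) : m (R - x) t = m x t := by
  rw [← h.even x t, ← h.m_per (-x) t]
  congr 1
  ring

theorem massTo_zero (m : ℝ → ℝ → ℝ) (t : ℝ) : massTo m 0 t = 0 := by simp [massTo]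

theorem hasDerivAt_massTo (h : DensityMomentum R T f g m mx v vx) (y t : ℝ) :
    HasDerivAt (fun y => massTo m y t) (m y t) y := by
  have := h.cm
  exact ((show Continuous fun x => m x t by fun_prop).integral_hasStrictDerivAt 0 y).hasDerivAt

theorem hasDerivAt_massTo_time (h : DensityMomentum R T f g m mx v vx) (y : ℝ) {t : ℝ}
    (ht : t ∈ Ioo 0 T) : HasDerivAt (massTo m y) (m y t * v y t) t := by
  have := h.cm; have := h.cmx; have := h.cv; have := h.cvx
  refine (hasDerivAt_integral_of_continuous
    (F' := fun x t => mx x t * v x t + m x t * vx x t) 0 y ht (fun t => by fun_prop)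
    (by fun_prop) h.hmt).congr_deriv ?_
  rw [intervalIntegral.integral_eq_sub_of_hasDerivAt (f := fun x => m x t * v x t)
    (fun x _ => (h.hmx x t).mul (h.hvx x t)) (Continuous.intervalIntegrable (by fun_prop) _ _),
    h.v_zero]
  ring

theorem continuous_massTo (h : DensityMomentum R T f g m mx v vx) (y : ℝ) :
    Continuous (massTo m y) := by
  have := h.cm
  exact intervalIntegral.continuous_parametric_intervalIntegral_of_continuous'
    (f := fun t x => m x t) (by fun_prop) 0 y

theorem strictMono_massTo (h : DensityMomentum R T f g m mx v vx) (t : ℝ) :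
    StrictMono fun y => massTo m y t :=
  strictMono_of_hasDerivAt_pos (fun y => h.hasDerivAt_massTo y t) fun y => h.pos y t

theorem mul_sub_le_massTo_sub (h : DensityMomentum R T f g m mx v vx) {μ : ℝ}
    (hμ : ∀ x t, μ ≤ m x t) (t : ℝ) {y z : ℝ} (hyz : y ≤ z) :
    μ * (z - y) ≤ massTo m z t - massTo m y t :=
  mul_sub_le_image_sub_of_le_deriv
    (fun y => (h.hasDerivAt_massTo y t).differentiableAt)
    (fun y => by rw [(h.hasDerivAt_massTo y t).deriv]; exact hμ y t) hyz

theorem surjective_massTo (h : DensityMomentum R T f g m mx v vx) (hR : 0 < R) (t : ℝ) :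
    Function.Surjective fun y => massTo m y t := by
  obtain ⟨μ, M, hμ, -, hb⟩ := h.exists_bounds hR
  have hlow := fun {y z : ℝ} => h.mul_sub_le_massTo_sub (fun x t => (hb x t).1) t (y := y) (z := z)
  refine Continuous.surjective
    (continuous_iff_continuousAt.2 fun y => (h.hasDerivAt_massTo y t).continuousAt) ?_ ?_
  · refine tendsto_atTop_mono' _ ?_ (tendsto_id.const_mul_atTop hμ)
    filter_upwards [eventually_ge_atTop 0] with y hy
    simpa [massTo_zero] using hlow hy
  · refine tendsto_atBot_mono' _ ?_ (tendsto_id.const_mul_atBot hμ)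
    filter_upwards [eventually_le_atBot 0] with y hy
    simpa [massTo_zero] using hlow hy

theorem massTo_massPos (h : DensityMomentum R T f g m mx v vx) (hR : 0 < R) (s t : ℝ) :
    massTo m (massPos m s t) t = s :=
  Function.rightInverse_invFun (h.surjective_massTo hR t) s

theorem massPos_massTo (h : DensityMomentum R T f g m mx v vx) (y t : ℝ) :
    massPos m (massTo m y t) t = y :=
  Function.leftInverse_invFun (h.strictMono_massTo t).injective y

theorem continuous_massPos (h : DensityMomentum R T f g m mx v vx) (hR : 0 < R) :
    Continuous (Function.uncurry (massPos m)) := by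
  obtain ⟨μ, M, hμ, -, hb⟩ := h.exists_bounds hR
  rw [continuous_iff_continuousAt]
  rintro ⟨s₀, t₀⟩
  set y₀ := massPos m s₀ t₀ with hy₀
  have hle : ∀ p : ℝ × ℝ,
      dist (Function.uncurry (massPos m) p) y₀ ≤ |p.1 - massTo m y₀ p.2| / μ := by
    rintro ⟨s, t⟩
    have hinv := h.massTo_massPos hR s t
    rw [le_div_iff₀ hμ, Real.dist_eq]
    simp only [Function.uncurry]
    rcases le_total y₀ (massPos m s t) with hle | hle
    · have := h.mul_sub_le_massTo_sub (fun x t => (hb x t).1) t hle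
      rw [hinv] at this
      rw [abs_of_nonneg (by linarith)]
      exact le_trans (by linarith) (le_abs_self _)
    · have := h.mul_sub_le_massTo_sub (fun x t => (hb x t).1) t hle
      rw [hinv] at this
      rw [abs_of_nonpos (by linarith)]
      exact le_trans (by linarith) (neg_le_abs _)
  have hc : Continuous fun p : ℝ × ℝ => |p.1 - massTo m y₀ p.2| / μ := by
    have := h.continuous_massTo y₀
    fun_prop
  refine tendsto_iff_dist_tendsto_zero.2
    (squeeze_zero (fun _ => dist_nonneg) hle ?_)
  have h0 := hc.tendsto (s₀, t₀)
  simpa [hy₀, h.massTo_massPos hR] using h0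

theorem hasDerivAt_massPos (h : DensityMomentum R T f g m mx v vx) (hR : 0 < R) (s t : ℝ) :
    HasDerivAt (fun s => massPos m s t) (m (massPos m s t) t)⁻¹ s := by
  have := h.continuous_massPos hR
  exact (h.hasDerivAt_massTo (massPos m s t) t).of_local_left_inverse
    (Continuous.continuousAt (by fun_prop)) (h.pos _ _).ne'
    (Eventually.of_forall fun s => h.massTo_massPos hR s t)

theorem hasDerivAt_massPos_time (h : DensityMomentum R T f g m mx v vx) (hR : 0 < R) (s : ℝ)
    {t : ℝ} (ht : t ∈ Ioo 0 T) :
    HasDerivAt (massPos m s) (-v (massPos m s t) t) t := by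
  have := h.cm; have := h.cv; have := h.continuous_massPos hR
  set y := massPos m s t with hy
  have ha : m y t ≠ 0 := (h.pos y t).ne'
  let e : (ℝ × ℝ) ≃L[ℝ] (ℝ × ℝ) := ContinuousLinearEquiv.equivOfInverse
    ((m y t • ContinuousLinearMap.fst ℝ ℝ ℝ +
      (m y t * v y t) • ContinuousLinearMap.snd ℝ ℝ ℝ).prod (ContinuousLinearMap.snd ℝ ℝ ℝ))
    (((m y t)⁻¹ • ContinuousLinearMap.fst ℝ ℝ ℝ +
      (-v y t) • ContinuousLinearMap.snd ℝ ℝ ℝ).prod (ContinuousLinearMap.snd ℝ ℝ ℝ))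
    (fun p => by ext <;> simp; field_simp; ring) (fun p => by ext <;> simp; field_simp; ring)
  have hP : HasFDerivAt (fun p : ℝ × ℝ => (Function.uncurry (massTo m) p, p.2))
      (e : (ℝ × ℝ) →L[ℝ] (ℝ × ℝ)) (y, t) :=
    (hasFDerivAt_uncurry_of_partial (Ft := fun y t => m y t * v y t) ht h.cm (by fun_prop)
      h.hasDerivAt_massTo (fun y t ht => h.hasDerivAt_massTo_time y ht)).prodMk hasFDerivAt_snd
  have hg : HasFDerivAt (fun p : ℝ × ℝ => (massPos m p.1 p.2, p.2))
      (e.symm : (ℝ × ℝ) →L[ℝ] (ℝ × ℝ)) (s, t) := by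
    refine HasFDerivAt.of_local_left_inverse
      (f := fun p : ℝ × ℝ => (Function.uncurry (massTo m) p, p.2))
      (Continuous.continuousAt (by fun_prop)) hP (Eventually.of_forall fun p => ?_)
    simp [Function.uncurry, h.massTo_massPos hR]
  have hline : HasDerivAt (fun τ => (s, τ)) ((0 : ℝ), (1 : ℝ)) t :=
    (hasDerivAt_const t s).prodMk (hasDerivAt_id t)
  have hcomp := (hasFDerivAt_fst.comp_hasDerivAt t (hg.comp_hasDerivAt t hline))
  refine HasDerivAt.congr_deriv (f := massPos m s) hcomp ?_
  simp [e]

end DensityMomentum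

theorem deriv_nonneg_of_monotoneOn_Ioi {f : ℝ → ℝ} (hf : MonotoneOn f (Ioi 0)) {x : ℝ}
    (hx : 0 < x) : 0 ≤ deriv f x := by
  rw [← derivWithin_of_isOpen isOpen_Ioi hx]
  exact hf.derivWithin_nonneg

theorem continuousOn_deriv_of_smooth {f : ℝ → ℝ} (hf : ContDiffOn ℝ (⊤ : ℕ∞) f (Ioi 0)) :
    ContinuousOn (deriv f) (Ioi 0) :=
  hf.continuousOn_deriv_of_isOpen isOpen_Ioi (by exact_mod_cast le_top)

/-- For smooth `f`, the function `x ↦ f' x * x ^ 3` is Lipschitz on compact subintervals of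
`(0, ∞)`. -/
theorem exists_lip_deriv_mul_cube {f : ℝ → ℝ} (hf : ContDiffOn ℝ (⊤ : ℕ∞) f (Ioi 0)) {μ M : ℝ}
    (hμ : 0 < μ) :
    ∃ L, 0 ≤ L ∧ ∀ a ∈ Icc μ M, ∀ b ∈ Icc μ M,
      |deriv f b * b ^ 3 - deriv f a * a ^ 3| ≤ L * |b - a| := by
  have hsub : Icc μ M ⊆ Ioi 0 := fun x hx => hμ.trans_le hx.1
  have hk : ContDiffOn ℝ 1 (fun x => deriv f x * x ^ 3) (Ioi 0) :=
    (hf.deriv_of_isOpen isOpen_Ioi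
      (WithTop.coe_le_coe.2 (le_top : (1 : ℕ∞) + 1 ≤ ⊤))).mul (contDiff_id.pow 3).contDiffOn
  obtain ⟨L, hL⟩ := (isCompact_Icc (a := μ) (b := M)).exists_bound_of_continuousOn
    ((hk.continuousOn_deriv_of_isOpen isOpen_Ioi le_rfl).mono hsub)
  refine ⟨max L 0, le_max_right _ _, fun a ha b hb => ?_⟩
  exact (convex_Icc μ M).norm_image_sub_le_of_norm_deriv_le
    (fun x hx => (hk.differentiableOn one_ne_zero).differentiableAt (isOpen_Ioi.mem_nhds (hsub hx)))
    (fun x hx => (hL x hx).trans (le_max_left _ _)) ha hb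

theorem eq_initial_of_hasDerivAt_zero {F : ℝ → ℝ} {T t : ℝ} (hc : ContinuousOn F (Icc 0 T))
    (hF : ∀ t ∈ Ioo 0 T, HasDerivAt F 0 t) (ht : t ∈ Icc 0 T) : F t = F 0 := by
  have h0 : (0 : ℝ) ∈ Icc 0 T := ⟨le_rfl, ht.1.trans ht.2⟩
  rw [← interior_Icc] at hF
  refine le_antisymm ?_ ?_
  · exact antitoneOn_of_deriv_nonpos (convex_Icc 0 T) hc
      (fun t ht => (hF t ht).differentiableAt.differentiableWithinAt)
      (fun t ht => (hF t ht).deriv.le) h0 ht ht.1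
  · exact monotoneOn_of_deriv_nonneg (convex_Icc 0 T) hc
      (fun t ht => (hF t ht).differentiableAt.differentiableWithinAt)
      (fun t ht => (hF t ht).deriv.ge) h0 ht ht.1

theorem neg_le_mul_sub_of_lip {k₁ k₂ w₁ w₂ L K ζ : ℝ} (hk : 0 ≤ k₂) (hL : |k₂ - k₁| ≤ L * |ζ|)
    (h₁ : |w₁| ≤ K) (h₂ : |w₂| ≤ K) :
    -(2 * L * K ^ 2 * |ζ|) ≤ (k₂ * w₂ - k₁ * w₁) * (w₂ - w₁) := by
  have hd : |w₂ - w₁| ≤ 2 * K := (abs_sub _ _).trans (by linarith)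
  have hK : 0 ≤ K := (abs_nonneg _).trans h₁
  have h : |(k₂ - k₁) * w₁ * (w₂ - w₁)| ≤ L * |ζ| * K * (2 * K) := by
    rw [abs_mul, abs_mul]
    have hLζ : 0 ≤ L * |ζ| := (abs_nonneg _).trans hL
    gcongr
  nlinarith [neg_abs_le ((k₂ - k₁) * w₁ * (w₂ - w₁)), mul_nonneg hk (sq_nonneg (w₂ - w₁))]

namespace DensityMomentum

variable {R T : ℝ} {f g : ℝ → ℝ} {m mx v vx : ℝ → ℝ → ℝ}

theorem massTo_neg (h : DensityMomentum R T f g m mx v vx) (y t : ℝ) :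
    massTo m (-y) t = -massTo m y t := by
  have := intervalIntegral.integral_comp_neg (fun x => m x t) (a := 0) (b := y)
  simp only [h.even, neg_zero] at this
  rw [massTo, massTo, this, intervalIntegral.integral_symm]

theorem massTo_reflect (h : DensityMomentum R T f g m mx v vx) (y t : ℝ) :
    massTo m (R - y) t = 2 * massTo m (R / 2) t - massTo m y t := by
  have hc : ∀ a b, IntervalIntegrable (fun x => m x t) volume a b := fun a b => by
    have := h.cm
    exact Continuous.intervalIntegrable (by fun_prop) _ _
  have h1 : ∀ y, ∫ x in y..(R / 2), m x t = ∫ x in (R / 2)..(R - y), m x t := fun y => by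
    have := intervalIntegral.integral_comp_sub_left (fun x => m x t) R (a := y) (b := R / 2)
    simp only [h.m_reflect] at this
    rw [this]
    congr 1
    ring
  have h2 := intervalIntegral.integral_add_adjacent_intervals (hc 0 y) (hc y (R / 2))
  have h3 := intervalIntegral.integral_add_adjacent_intervals (hc 0 (R / 2)) (hc (R / 2) (R - y))
  rw [← h1] at h3
  simp only [massTo]
  linarith

theorem massTo_half (h : DensityMomentum R T f g m mx v vx) (hT : 0 < T) (t : ℝ) :
    massTo m (R / 2) t = massTo m (R / 2) 0 := by
  have hcl : massTo m (R / 2) t = massTo m (R / 2) (max 0 (min t T)) := by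
    simp only [massTo, fun x => h.clamp x t]
  have hmem : max 0 (min t T) ∈ Icc 0 T :=
    ⟨le_max_left _ _, max_le hT.le (min_le_right _ _)⟩
  rw [hcl]
  refine eq_initial_of_hasDerivAt_zero (F := massTo m (R / 2))
    (h.continuous_massTo (R / 2)).continuousOn (fun t ht => ?_) hmem
  refine (h.hasDerivAt_massTo_time (R / 2) ht).congr_deriv ?_
  rw [h.v_half, mul_zero]

theorem massPos_neg (h : DensityMomentum R T f g m mx v vx) (hR : 0 < R) (s t : ℝ) :
    massPos m (-s) t = -massPos m s t := by
  rw [← h.massPos_massTo (-massPos m s t) t, h.massTo_neg, h.massTo_massPos hR]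

theorem massPos_reflect (h : DensityMomentum R T f g m mx v vx) (hR : 0 < R) (hT : 0 < T)
    (s t : ℝ) : massPos m (2 * massTo m (R / 2) 0 - s) t = R - massPos m s t := by
  have := h.massPos_massTo (R - massPos m s t) t
  rwa [h.massTo_reflect, h.massTo_massPos hR, h.massTo_half hT t] at this

theorem massTo_mem_Icc (h : DensityMomentum R T f g m mx v vx) (hT : 0 < T) {y t : ℝ}
    (hy : y ∈ Icc 0 (R / 2)) : massTo m y t ∈ Icc 0 (massTo m (R / 2) 0) := by
  rw [← h.massTo_half hT t, ← massTo_zero m t]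
  exact ⟨(h.strictMono_massTo t).monotone hy.1, (h.strictMono_massTo t).monotone hy.2⟩

theorem massPos_mem_Icc (h : DensityMomentum R T f g m mx v vx) (hR : 0 < R) (hT : 0 < T)
    {s t : ℝ} (hs : s ∈ Icc 0 (massTo m (R / 2) 0)) : massPos m s t ∈ Icc 0 (R / 2) := by
  rw [← h.massTo_half hT t, ← massTo_zero m t, ← h.massTo_massPos hR s t] at hs
  exact ⟨(h.strictMono_massTo t).le_iff_le.1 hs.1, (h.strictMono_massTo t).le_iff_le.1 hs.2⟩

theorem monotone_massPos (h : DensityMomentum R T f g m mx v vx) (hR : 0 < R) (t : ℝ) :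
    Monotone fun s => massPos m s t := fun s₁ s₂ hs => by
  refine (h.strictMono_massTo t).le_iff_le.1 ?_
  simpa only [h.massTo_massPos hR] using hs

/-- In mass coordinates the momentum evolves only through the pressure. -/
theorem hasDerivAt_momentum_massPos (h : DensityMomentum R T f g m mx v vx) (hR : 0 < R)
    (hf : ContinuousOn (deriv f) (Ioi 0)) (s : ℝ) {t : ℝ} (ht : t ∈ Ioo 0 T) :
    HasDerivAt (fun t => v (massPos m s t) t)
      (-(deriv f (m (massPos m s t) t) * mx (massPos m s t) t)) t := by
  have := h.cm; have := h.cmx; have := h.cv; have := h.cvx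
  have hc : Continuous fun p : ℝ × ℝ => deriv f (m p.1 p.2) :=
    hf.comp_continuous (by fun_prop) fun p => h.pos _ _
  refine (hasDerivAt_along_curve (Ft := fun x t => v x t * vx x t - deriv f (m x t) * mx x t)
    ht h.cvx (by fun_prop) h.hvx h.hvt (h.hasDerivAt_massPos_time hR s ht)).congr_deriv ?_
  ring

/-- The density stays nonincreasing on the half period. -/
theorem antitoneOn_density (h : DensityMomentum R T f g m mx v vx) (hR : 0 < R) (hT : 0 < T)
    (hf : ContDiffOn ℝ (⊤ : ℕ∞) f (Ioi 0)) (hg : ContDiffOn ℝ (⊤ : ℕ∞) g (Ioi 0))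
    (hfmono : MonotoneOn f (Ioi 0)) (hgmono : MonotoneOn g (Ioi 0))
    (h0 : AntitoneOn (fun x => m x 0) (Icc 0 (R / 2))) {t : ℝ} (ht : t ∈ Icc 0 T) :
    AntitoneOn (fun x => m x t) (Icc 0 (R / 2)) := by
  have := h.cm; have := h.cmx; have := h.cv; have := h.cvx
  have cpos := h.continuous_massPos hR
  have hne : ∀ x t, m x t ≠ 0 := fun x t => (h.pos x t).ne'
  have cf : Continuous fun p : ℝ × ℝ => deriv f (m p.1 p.2) :=
    (continuousOn_deriv_of_smooth hf).comp_continuous (by fun_prop) fun p => h.pos _ _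
  have cinv : Continuous fun p : ℝ × ℝ => (m p.1 p.2)⁻¹ :=
    Continuous.inv₀ (by fun_prop) fun p => hne _ _
  set X := massPos m with hX
  set S := massTo m (R / 2) 0 with hS
  have hS0 : 0 < S := by
    rw [← massTo_zero m 0]
    exact h.strictMono_massTo 0 (half_pos hR)
  set W : ℝ → ℝ → ℝ := fun s t => (m (X s t) t)⁻¹ with hW
  set Ws : ℝ → ℝ → ℝ := fun s t => -(mx (X s t) t * ((m (X s t) t)⁻¹) ^ 3) with hWs_def
  set V : ℝ → ℝ → ℝ := fun s t => v (X s t) t with hV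
  set Vs : ℝ → ℝ → ℝ := fun s t => vx (X s t) t * (m (X s t) t)⁻¹ with hVs_def
  set Vt : ℝ → ℝ → ℝ := fun s t => -(deriv f (m (X s t) t) * mx (X s t) t) with hVt_def
  have cW : Continuous (Function.uncurry W) := cinv.comp (cpos.prodMk continuous_snd)
  have cWs : Continuous (Function.uncurry Ws) := by
    have : Continuous fun p : ℝ × ℝ => W p.1 p.2 := cW
    have : Continuous fun p : ℝ × ℝ => -(mx (X p.1 p.2) p.2 * (W p.1 p.2) ^ 3) := by fun_prop
    exact this
  have cV : Continuous (Function.uncurry V) := by fun_prop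
  have cVs : Continuous (Function.uncurry Vs) := by
    have : Continuous fun p : ℝ × ℝ => W p.1 p.2 := cW
    have : Continuous fun p : ℝ × ℝ => vx (X p.1 p.2) p.2 * W p.1 p.2 := by fun_prop
    exact this
  have cVt : Continuous (Function.uncurry Vt) :=
    ((cf.comp (cpos.prodMk continuous_snd)).mul (show Continuous fun p : ℝ × ℝ =>
      mx (X p.1 p.2) p.2 by fun_prop)).neg
  have hWs : ∀ s t, HasDerivAt (fun s => W s t) (Ws s t) s := fun s t => by
    refine ((HasDerivAt.comp (h₂ := fun y => m y t) s (h.hmx _ t)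
      (h.hasDerivAt_massPos hR s t)).inv (hne _ _)).congr_deriv ?_
    simp only [hWs_def, hX, Function.comp]
    field_simp [hne]
  have hVs : ∀ s t, HasDerivAt (fun s => V s t) (Vs s t) s := fun s t =>
    HasDerivAt.comp (h₂ := fun y => v y t) s (h.hvx _ t) (h.hasDerivAt_massPos hR s t)
  have hWt : ∀ s, ∀ t ∈ Ioo 0 T, HasDerivAt (W s) (-Vs s t) t := fun s t ht => by
    refine ((hasDerivAt_along_curve (Ft := fun x t => mx x t * v x t + m x t * vx x t)
      ht h.cmx (by fun_prop) h.hmx h.hmt (h.hasDerivAt_massPos_time hR s ht)).inv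
        (hne _ _)).congr_deriv ?_
    simp only [hVs_def]
    field_simp [hne]
    ring
  have hVt : ∀ s, ∀ t ∈ Ioo 0 T, HasDerivAt (V s) (Vt s t) t := fun s t ht =>
    h.hasDerivAt_momentum_massPos hR (continuousOn_deriv_of_smooth hf) s ht
  have hVtW : ∀ s t, Vt s t = deriv f (m (X s t) t) * m (X s t) t ^ 3 * Ws s t := fun s t => by
    simp only [hVt_def, hWs_def]
    field_simp [hne]
  have hVT : ∀ s, V s T = -(deriv g (m (X s T) T) * m (X s T) T ^ 3 * Ws s T) := fun s => by
    simp only [hV, hWs_def, h.term]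
    field_simp [hne]
  have Wneg : ∀ s t, W (-s) t = W s t := fun s t => by
    simp only [hW, hX, h.massPos_neg hR, h.even]
  have Wrefl : ∀ s t, W (2 * S - s) t = W s t := fun s t => by
    simp only [hW, hX, hS, h.massPos_reflect hR hT, h.m_reflect]
  have W0 : ∀ s₁ s₂, 0 ≤ s₁ → s₁ ≤ s₂ → s₂ ≤ S → W s₁ 0 ≤ W s₂ 0 := fun s₁ s₂ h1 h12 h2 =>
    inv_anti₀ (h.pos _ _) (h0 (h.massPos_mem_Icc hR hT ⟨h1, h12.trans h2⟩)
      (h.massPos_mem_Icc hR hT ⟨h1.trans h12, h2⟩) (h.monotone_massPos hR 0 h12))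
  obtain ⟨μ, M, hμ, hμM, hmM⟩ := h.exists_bounds hR
  obtain ⟨Lf, hLf0, hLf⟩ := exists_lip_deriv_mul_cube hf hμ (M := M)
  obtain ⟨Lg, hLg0, hLg⟩ := exists_lip_deriv_mul_cube hg hμ (M := M)
  obtain ⟨K, hK0, hK⟩ := exists_bound_rect cWs (-S) (2 * S) 0 T
  have hmW : ∀ s₁ s₂ t, |m (X s₂ t) t - m (X s₁ t) t| ≤ M ^ 2 * |W s₂ t - W s₁ t| := by
    intro s₁ s₂ t
    have heq : m (X s₂ t) t - m (X s₁ t) t =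
        -(m (X s₁ t) t * m (X s₂ t) t * (W s₂ t - W s₁ t)) := by
      simp only [hW]
      field_simp [hne]
      ring
    rw [heq, abs_neg, abs_mul]
    have h1 := hmM (X s₁ t) t
    have h2 := hmM (X s₂ t) t
    rw [abs_of_pos (mul_pos (h.pos _ _) (h.pos _ _)), sq]
    exact mul_le_mul_of_nonneg_right
      (mul_le_mul h1.2 h2.2 (h.pos _ _).le (hμ.le.trans hμM)) (abs_nonneg _)
  have main : ∀ δ ∈ Icc 0 S, ∀ s ∈ Icc (-(δ / 2)) (S - δ / 2), ∀ t ∈ Icc 0 T,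
      0 ≤ W (s + δ) t - W s t := by
    intro δ hδ
    have hrange : ∀ s ∈ Icc (-(δ / 2)) (S - δ / 2),
        s ∈ uIcc (-S) (2 * S) ∧ s + δ ∈ uIcc (-S) (2 * S) := fun s hs => by
      rw [uIcc_of_le (by linarith)]
      exact ⟨⟨by linarith [hs.1, hδ.2], by linarith [hs.2, hδ.1]⟩,
        ⟨by linarith [hs.1, hδ.2, hδ.1], by linarith [hs.2, hδ.1, hδ.2]⟩⟩
    have hest : ∀ (p : ℝ → ℝ) (L : ℝ), MonotoneOn p (Ioi 0) →
        (∀ a ∈ Icc μ M, ∀ b ∈ Icc μ M, |deriv p b * b ^ 3 - deriv p a * a ^ 3| ≤ L * |b - a|) →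
        0 ≤ L → L ≤ max Lf Lg → ∀ s ∈ Icc (-(δ / 2)) (S - δ / 2), ∀ t ∈ Icc 0 T,
        -(2 * (max Lf Lg * M ^ 2) * K ^ 2 * |W (s + δ) t - W s t|) ≤
          (deriv p (m (X (s + δ) t) t) * m (X (s + δ) t) t ^ 3 * Ws (s + δ) t -
            deriv p (m (X s t) t) * m (X s t) t ^ 3 * Ws s t) * (Ws (s + δ) t - Ws s t) := by
      intro p L hp hL hL0 hLmax s hs t ht
      refine neg_le_mul_sub_of_lip
        (mul_nonneg (deriv_nonneg_of_monotoneOn_Ioi hp (h.pos _ _)) (pow_nonneg (h.pos _ _).le 3))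
        ?_ (hK _ (hrange s hs).1 t ht) (hK _ (hrange s hs).2 t ht)
      calc _ ≤ L * |m (X (s + δ) t) t - m (X s t) t| := hL _ (hmM _ _) _ (hmM _ _)
        _ ≤ max Lf Lg * (M ^ 2 * |W (s + δ) t - W s t|) :=
          mul_le_mul hLmax (hmW _ _ _) (abs_nonneg _) (hLf0.trans (le_max_left _ _))
        _ = _ := by ring
    refine nonneg_of_degenerate_elliptic (C := 2 * (max Lf Lg * M ^ 2) * K ^ 2)
      (Z := fun s t => W (s + δ) t - W s t) (Zs := fun s t => Ws (s + δ) t - Ws s t)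
      (Y := fun s t => V (s + δ) t - V s t) (Ys := fun s t => Vs (s + δ) t - Vs s t)
      (Yt := fun s t => Vt (s + δ) t - Vt s t) (by linarith) hT ?_ (by fun_prop) (by fun_prop)
      (by fun_prop) (by fun_prop) (by fun_prop)
      (fun s t => ((hWs (s + δ) t).comp_add_const s δ).sub (hWs s t))
      (fun s t => ((hVs (s + δ) t).comp_add_const s δ).sub (hVs s t))
      (fun s t ht => ((hWt (s + δ) t ht).sub (hWt s t ht)).congr_deriv (by ring))
      (fun s t ht => (hVt (s + δ) t ht).sub (hVt s t ht)) (fun t => ?_) (fun t => ?_) ?_ ?_ ?_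
    · have := hLf0.trans (le_max_left Lf Lg)
      positivity
    · rw [Wneg, show -(δ / 2) + δ = δ / 2 by ring, sub_self]
    · have := Wrefl (S - δ / 2) t
      rw [show 2 * S - (S - δ / 2) = S - δ / 2 + δ by ring] at this
      rw [this, sub_self]
    · intro s hs
      rw [sub_nonneg]
      rcases le_total 0 s with hs0 | hs0
      · rcases le_total (s + δ) S with hsS | hsS
        · exact W0 _ _ hs0 (by linarith [hδ.1]) hsS
        · rw [← Wrefl (s + δ)]
          exact W0 _ _ hs0 (by linarith [hs.2]) (by linarith)
      · rw [← Wneg s]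
        exact W0 _ _ (by linarith) (by linarith [hs.1]) (by linarith [hδ.2])
    · intro s hs t ht
      have := hest f Lf hfmono hLf hLf0 (le_max_left _ _) s hs t (Ioo_subset_Icc_self ht)
      simpa only [hVtW] using this
    · intro s hs
      have := hest g Lg hgmono hLg hLg0 (le_max_right _ _) s hs T (right_mem_Icc.2 hT.le)
      simp only [hVT]
      linarith
  intro y₁ hy₁ y₂ hy₂ hy
  have hs₁ := h.massTo_mem_Icc hT hy₁ (t := t)
  have hs₂ := h.massTo_mem_Icc hT hy₂ (t := t)
  have hs := (h.strictMono_massTo t).monotone hy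
  have key := main (massTo m y₂ t - massTo m y₁ t)
    ⟨by linarith, by linarith [hs₁.1, hs₂.2]⟩ (massTo m y₁ t)
    ⟨by linarith [hs₁.1], by linarith [hs₂.2]⟩ t ht
  rw [add_sub_cancel, sub_nonneg] at key
  simp only [hW, hX, h.massPos_massTo] at key
  exact (inv_le_inv₀ (h.pos _ _) (h.pos _ _)).1 key

end DensityMomentum

theorem convex_strip (T : ℝ) : Convex ℝ {p : ℝ × ℝ | p.2 ∈ Icc 0 T} :=
  (convex_Icc 0 T).linear_preimage (LinearMap.snd ℝ ℝ ℝ)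

theorem strip_mem_nhds {T t : ℝ} (x : ℝ) (ht : t ∈ Ioo 0 T) :
    {p : ℝ × ℝ | p.2 ∈ Icc 0 T} ∈ 𝓝 (x, t) :=
  continuous_snd.continuousAt.preimage_mem_nhds (Icc_mem_nhds ht.1 ht.2)

theorem interior_strip_nonempty {T : ℝ} (hT : 0 < T) :
    (interior {p : ℝ × ℝ | p.2 ∈ Icc 0 T}).Nonempty :=
  ⟨(0, T / 2), mem_interior_iff_mem_nhds.2 (strip_mem_nhds 0 ⟨half_pos hT, half_lt_self hT⟩)⟩

theorem uniqueDiffOn_strip {T : ℝ} (hT : 0 < T) :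
    UniqueDiffOn ℝ {p : ℝ × ℝ | p.2 ∈ Icc 0 T} :=
  uniqueDiffOn_convex (convex_strip T) (interior_strip_nonempty hT)

/-- Directional derivative, in the direction `e`, relative to the strip `ℝ × [0, T]`. -/
noncomputable def stripDeriv (T : ℝ) (F : ℝ × ℝ → ℝ) (e p : ℝ × ℝ) : ℝ :=
  fderivWithin ℝ F {p : ℝ × ℝ | p.2 ∈ Icc 0 T} p e

theorem contDiffOn_stripDeriv {T : ℝ} (hT : 0 < T) {F : ℝ × ℝ → ℝ}
    (hF : ContDiffOn ℝ 2 F {p : ℝ × ℝ | p.2 ∈ Icc 0 T}) (e : ℝ × ℝ) :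
    ContDiffOn ℝ 1 (stripDeriv T F e) {p : ℝ × ℝ | p.2 ∈ Icc 0 T} :=
  (hF.fderivWithin (uniqueDiffOn_strip hT) (by norm_num)).clm_apply contDiffOn_const

theorem continuousOn_stripDeriv {T : ℝ} (hT : 0 < T) {F : ℝ × ℝ → ℝ}
    (hF : ContDiffOn ℝ 1 F {p : ℝ × ℝ | p.2 ∈ Icc 0 T}) (e : ℝ × ℝ) :
    ContinuousOn (stripDeriv T F e) {p : ℝ × ℝ | p.2 ∈ Icc 0 T} :=
  (hF.continuousOn_fderivWithin (uniqueDiffOn_strip hT) le_rfl).clm_apply continuousOn_const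

theorem hasDerivAt_stripDeriv_space {T t : ℝ} {F : ℝ × ℝ → ℝ}
    (hF : ContDiffOn ℝ 1 F {p : ℝ × ℝ | p.2 ∈ Icc 0 T}) (x : ℝ) (ht : t ∈ Icc 0 T) :
    HasDerivAt (fun y => F (y, t)) (stripDeriv T F (1, 0) (x, t)) x :=
  ((hF.differentiableOn one_ne_zero (x, t) ht).hasFDerivWithinAt.comp_hasDerivAt x
    ((hasDerivAt_id x).prodMk (hasDerivAt_const x t)) (Eventually.of_forall fun _ => ht) :)

theorem hasDerivAt_stripDeriv_time {T t : ℝ} {F : ℝ × ℝ → ℝ}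
    (hF : ContDiffOn ℝ 1 F {p : ℝ × ℝ | p.2 ∈ Icc 0 T}) (x : ℝ) (ht : t ∈ Ioo 0 T) :
    HasDerivAt (fun s => F (x, s)) (stripDeriv T F (0, 1) (x, t)) t :=
  ((hF.differentiableOn one_ne_zero (x, t)
    (Ioo_subset_Icc_self ht)).hasFDerivWithinAt.comp_hasDerivAt t
    ((hasDerivAt_const t x).prodMk (hasDerivAt_id t)) (Icc_mem_nhds ht.1 ht.2) :)

theorem stripDeriv_comm {T : ℝ} (hT : 0 < T) {F : ℝ × ℝ → ℝ}
    (hF : ContDiffOn ℝ 2 F {p : ℝ × ℝ | p.2 ∈ Icc 0 T}) (a b : ℝ × ℝ) {p : ℝ × ℝ}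
    (hp : p ∈ {p : ℝ × ℝ | p.2 ∈ Icc 0 T}) :
    stripDeriv T (stripDeriv T F a) b p = stripDeriv T (stripDeriv T F b) a p := by
  have hu := uniqueDiffOn_strip hT
  have hD : DifferentiableWithinAt ℝ (fderivWithin ℝ F {p : ℝ × ℝ | p.2 ∈ Icc 0 T})
      {p : ℝ × ℝ | p.2 ∈ Icc 0 T} p :=
    (hF.fderivWithin hu (by norm_num : (1 : WithTop ℕ∞) + 1 ≤ 2)).differentiableOn one_ne_zero p hp
  have hsecond : ∀ a b, stripDeriv T (stripDeriv T F a) b p =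
      fderivWithin ℝ (fderivWithin ℝ F {p : ℝ × ℝ | p.2 ∈ Icc 0 T})
        {p : ℝ × ℝ | p.2 ∈ Icc 0 T} p b a := fun a b => by
    have := ((ContinuousLinearMap.apply ℝ ℝ a).hasFDerivAt.comp_hasFDerivWithinAt p
      hD.hasFDerivWithinAt).fderivWithin (hu p hp)
    exact congrArg (fun L => L b) this
  rw [hsecond, hsecond]
  refine (hF p hp).isSymmSndFDerivWithinAt (by simp) hu ?_ hp b a
  rw [(convex_strip T).closure_interior_eq_closure_of_nonempty_interior
    (interior_strip_nonempty hT)]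
  exact subset_closure hp

theorem continuous_clamp {T : ℝ} (hT : 0 ≤ T) {F : ℝ → ℝ → ℝ}
    (hF : ContinuousOn (fun p : ℝ × ℝ => F p.1 p.2) {p : ℝ × ℝ | p.2 ∈ Icc 0 T}) :
    Continuous (Function.uncurry fun x t => F x (max 0 (min t T))) :=
  hF.comp_continuous (f := fun p : ℝ × ℝ => (p.1, max 0 (min p.2 T))) (by fun_prop)
    fun _ => ⟨le_max_left _ _, max_le hT (min_le_right _ _)⟩

theorem clamp_of_mem {T t : ℝ} (ht : t ∈ Icc 0 T) : max 0 (min t T) = t := by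
  rw [min_eq_left ht.2, max_eq_right ht.1]

theorem clamp_eventuallyEq {T t : ℝ} (F : ℝ → ℝ) (ht : t ∈ Ioo 0 T) :
    (fun s => F (max 0 (min s T))) =ᶠ[𝓝 t] F := by
  filter_upwards [Icc_mem_nhds ht.1 ht.2] with s hs
  rw [clamp_of_mem hs]

theorem pdx_eq_stripDeriv {T t : ℝ} {F : ℝ → ℝ → ℝ}
    (hF : ContDiffOn ℝ 1 (fun p : ℝ × ℝ => F p.1 p.2) {p : ℝ × ℝ | p.2 ∈ Icc 0 T}) (x : ℝ)
    (ht : t ∈ Icc 0 T) : pdx F x t = stripDeriv T (fun p => F p.1 p.2) (1, 0) (x, t) :=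
  (hasDerivAt_stripDeriv_space hF x ht).deriv

theorem hasDerivAt_pdx {T t : ℝ} {F : ℝ → ℝ → ℝ}
    (hF : ContDiffOn ℝ 1 (fun p : ℝ × ℝ => F p.1 p.2) {p : ℝ × ℝ | p.2 ∈ Icc 0 T}) (x : ℝ)
    (ht : t ∈ Icc 0 T) : HasDerivAt (fun y => F y t) (pdx F x t) x :=
  (hasDerivAt_stripDeriv_space hF x ht).differentiableAt.hasDerivAt

theorem hasDerivAt_pdt {T t : ℝ} {F : ℝ → ℝ → ℝ}
    (hF : ContDiffOn ℝ 1 (fun p : ℝ × ℝ => F p.1 p.2) {p : ℝ × ℝ | p.2 ∈ Icc 0 T}) (x : ℝ)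
    (ht : t ∈ Ioo 0 T) : HasDerivAt (F x) (pdt F x t) t :=
  (hasDerivAt_stripDeriv_time hF x ht).differentiableAt.hasDerivAt

theorem continuousOn_pdx {T : ℝ} (hT : 0 < T) {F : ℝ → ℝ → ℝ}
    (hF : ContDiffOn ℝ 1 (fun p : ℝ × ℝ => F p.1 p.2) {p : ℝ × ℝ | p.2 ∈ Icc 0 T}) :
    ContinuousOn (fun p : ℝ × ℝ => pdx F p.1 p.2) {p : ℝ × ℝ | p.2 ∈ Icc 0 T} :=
  (continuousOn_stripDeriv hT hF (1, 0)).congr fun p hp => pdx_eq_stripDeriv hF p.1 hp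

theorem contDiffOn_pdx {T : ℝ} (hT : 0 < T) {F : ℝ → ℝ → ℝ}
    (hF : ContDiffOn ℝ 2 (fun p : ℝ × ℝ => F p.1 p.2) {p : ℝ × ℝ | p.2 ∈ Icc 0 T}) :
    ContDiffOn ℝ 1 (fun p : ℝ × ℝ => pdx F p.1 p.2) {p : ℝ × ℝ | p.2 ∈ Icc 0 T} :=
  (contDiffOn_stripDeriv hT hF (1, 0)).congr fun p hp =>
    pdx_eq_stripDeriv (hF.of_le one_le_two) p.1 hp

theorem pdt_pdx_eq_pdx_pdt {T t : ℝ} (hT : 0 < T) {F : ℝ → ℝ → ℝ}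
    (hF : ContDiffOn ℝ 2 (fun p : ℝ × ℝ => F p.1 p.2) {p : ℝ × ℝ | p.2 ∈ Icc 0 T}) (x : ℝ)
    (ht : t ∈ Ioo 0 T) : pdt (pdx F) x t = pdx (pdt F) x t := by
  have ht' := Ioo_subset_Icc_self ht
  have hF1 := hF.of_le one_le_two
  have hx : ∀ᶠ s in 𝓝 t, pdx F x s = stripDeriv T (fun p => F p.1 p.2) (1, 0) (x, s) := by
    filter_upwards [Icc_mem_nhds ht.1 ht.2] with s hs using pdx_eq_stripDeriv hF1 x hs
  have hs : ∀ y, pdt F y t = stripDeriv T (fun p => F p.1 p.2) (0, 1) (y, t) := fun y =>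
    (hasDerivAt_stripDeriv_time hF1 y ht).deriv
  rw [pdt, EventuallyEq.deriv_eq hx, (hasDerivAt_stripDeriv_time (contDiffOn_stripDeriv hT hF _) x ht).deriv,
    stripDeriv_comm hT hF _ _ ht', pdx, funext hs,
    (hasDerivAt_stripDeriv_space (contDiffOn_stripDeriv hT hF _) x ht').deriv]

theorem pdx_comp_neg (F : ℝ → ℝ → ℝ) (x t : ℝ) :
    pdx (fun y s => F (-y) s) x t = -pdx F (-x) t :=
  deriv_comp_neg (fun y => F y t) x

theorem pdx_add_period {F : ℝ → ℝ → ℝ} {R t : ℝ} (hF : ∀ x, F (x + R) t = F x t) (x : ℝ) :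
    pdx F (x + R) t = pdx F x t := by
  rw [pdx, ← deriv_comp_add_const (f := fun y => F y t)]
  simp only [hF, pdx]

theorem TermSol.comp_neg {R T : ℝ} {f g : ℝ → ℝ} {u m : ℝ → ℝ → ℝ} (h : TermSol R T f g u m) :
    TermSol R T f g (fun x t => u (-x) t) (fun x t => m (-x) t) := by
  obtain ⟨hu, hm, uper, mper, mpos, hHJ, hFP, hterm⟩ := h
  have hmaps : MapsTo (fun p : ℝ × ℝ => (-p.1, p.2)) {p : ℝ × ℝ | p.2 ∈ Icc 0 T}
      {p : ℝ × ℝ | p.2 ∈ Icc 0 T} := fun p hp => hp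
  have hneg : ∀ n : WithTop ℕ∞, ContDiffOn ℝ n (fun p : ℝ × ℝ => (-p.1, p.2))
      {p : ℝ × ℝ | p.2 ∈ Icc 0 T} := fun n =>
    (contDiff_fst.neg.prodMk contDiff_snd).contDiffOn
  refine ⟨hu.comp (hneg 2) hmaps, hm.comp (hneg 1) hmaps, fun x t => ?_, fun x t => ?_,
    fun x t ht => mpos _ t ht, fun x t ht => ?_, fun x t ht => ?_, fun x => hterm _⟩
  · show u _ t = u _ t
    rw [← uper (-(x + R)), show -(x + R) + R = -x by ring]
  · show m _ t = m _ t
    rw [← mper (-(x + R)), show -(x + R) + R = -x by ring]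
  · rw [pdx_comp_neg, neg_sq]
    exact hHJ (-x) t ht
  · have hprod : (fun y s => m (-y) s * pdx (fun x t => u (-x) t) y s) =
        fun y s => (fun y s => -(m y s * pdx u y s)) (-y) s := by
      ext y s
      simp only [pdx_comp_neg]
      ring
    rw [hprod, pdx_comp_neg fun y s => -(m y s * pdx u y s),
      show pdx (fun y s => -(m y s * pdx u y s)) (-x) t =
        -pdx (fun y s => m y s * pdx u y s) (-x) t from deriv.fun_neg, neg_neg]
    exact hFP (-x) t ht

/-- The density and the momentum of a symmetric solution, with time frozen outside `[0, T]`. -/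
theorem TermSol.densityMomentum {R T : ℝ} (hT : 0 < T) {f g : ℝ → ℝ} {u m : ℝ → ℝ → ℝ}
    (hf : DifferentiableOn ℝ f (Ioi 0)) (hg : DifferentiableOn ℝ g (Ioi 0))
    (h : TermSol R T f g u m) (ueven : ∀ x, ∀ t ∈ Icc 0 T, u (-x) t = u x t)
    (meven : ∀ x, ∀ t ∈ Icc 0 T, m (-x) t = m x t) :
    DensityMomentum R T f g (fun x t => m x (max 0 (min t T)))
      (fun x t => pdx m x (max 0 (min t T))) (fun x t => pdx u x (max 0 (min t T)))
      (fun x t => pdx (pdx u) x (max 0 (min t T))) := by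
  obtain ⟨hu, hm, uper, mper, mpos, hHJ, hFP, hterm⟩ := h
  have hmem : ∀ t, max 0 (min t T) ∈ Icc 0 T := fun t =>
    ⟨le_max_left _ _, max_le hT.le (min_le_right _ _)⟩
  have hv := contDiffOn_pdx hT hu
  have hfm : ∀ (p : ℝ → ℝ), DifferentiableOn ℝ p (Ioi 0) → ∀ x, ∀ t ∈ Icc 0 T,
      HasDerivAt (fun y => p (m y t)) (deriv p (m x t) * pdx m x t) x := fun p hp x t ht =>
    HasDerivAt.comp x (hp.differentiableAt (isOpen_Ioi.mem_nhds (mpos x t ht))).hasDerivAt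
      (hasDerivAt_pdx hm x ht)
  refine
    { cm := continuous_clamp hT.le hm.continuousOn
      cmx := continuous_clamp hT.le (continuousOn_pdx hT hm)
      cv := continuous_clamp hT.le hv.continuousOn
      cvx := continuous_clamp hT.le (continuousOn_pdx hT hv)
      pos := fun x t => mpos x _ (hmem t)
      hmx := fun x t => hasDerivAt_pdx hm x (hmem t)
      hvx := fun x t => hasDerivAt_pdx hv x (hmem t)
      hmt := fun x t ht => ?_
      hvt := fun x t ht => ?_
      term := fun x => ?_
      even := fun x t => meven x _ (hmem t)
      odd := fun x t => ?_
      m_per := fun x t => mper x _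
      v_per := fun x t => pdx_add_period (fun x => uper x _) x
      clamp := fun x t => by rw [clamp_of_mem (hmem t)] }
  · have ht' := Ioo_subset_Icc_self ht
    rw [clamp_of_mem ht']
    refine ((hasDerivAt_pdt hm x ht).congr_of_eventuallyEq
      (clamp_eventuallyEq (m x) ht)).congr_deriv ?_
    rw [sub_eq_zero.1 (hFP x t ht')]
    exact ((hasDerivAt_pdx hm x ht').mul (hasDerivAt_pdx hv x ht')).deriv
  · have ht' := Ioo_subset_Icc_self ht
    rw [clamp_of_mem ht']
    refine ((hasDerivAt_pdt hv x ht).congr_of_eventuallyEq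
      (clamp_eventuallyEq (pdx u x) ht)).congr_deriv ?_
    have hut : (fun y => pdt u y t) = fun y => 1 / 2 * pdx u y t ^ 2 - f (m y t) := by
      ext y
      linarith [hHJ y t ht']
    rw [pdt_pdx_eq_pdx_pdt hT hu x ht, pdx, hut]
    refine ((((hasDerivAt_pdx hv x ht').fun_pow 2).const_mul (1 / 2)).fun_sub
      (hfm f hf x t ht')).deriv.trans ?_
    ring
  · have hT' : T ∈ Icc 0 T := right_mem_Icc.2 hT.le
    rw [clamp_of_mem hT', pdx, funext hterm, (hfm g hg x T hT').deriv]
  · have := pdx_comp_neg u x (max 0 (min t T))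
    rw [pdx] at this
    simp only [ueven _ _ (hmem t)] at this
    rw [← neg_eq_iff_eq_neg, ← this, pdx]

namespace DensityMomentum

variable {R T : ℝ} {f g : ℝ → ℝ} {m mx v vx : ℝ → ℝ → ℝ}

/-- The momentum is monotone in time in mass coordinates. -/
theorem monotoneOn_momentum_massPos (h : DensityMomentum R T f g m mx v vx) (hR : 0 < R)
    (hT : 0 < T) (hf : ContinuousOn (deriv f) (Ioi 0)) (hfmono : MonotoneOn f (Ioi 0))
    (hmx : ∀ y ∈ Icc 0 (R / 2), ∀ t ∈ Icc 0 T, mx y t ≤ 0) {s : ℝ}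
    (hs : s ∈ Icc 0 (massTo m (R / 2) 0)) :
    MonotoneOn (fun t => v (massPos m s t) t) (Icc 0 T) := by
  have := h.cv; have := h.continuous_massPos hR
  have hd := fun t ht => h.hasDerivAt_momentum_massPos hR hf s (t := t) ht
  rw [← interior_Icc] at hd
  refine monotoneOn_of_deriv_nonneg (convex_Icc 0 T) (by fun_prop)
    (fun t ht => (hd t ht).differentiableAt.differentiableWithinAt) fun t ht => ?_
  rw [(hd t ht).deriv, neg_nonneg]
  exact mul_nonpos_of_nonneg_of_nonpos (deriv_nonneg_of_monotoneOn_Ioi hfmono (h.pos _ _))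
    (hmx _ (h.massPos_mem_Icc hR hT hs) t (interior_subset ht))

theorem mx_nonpos (h : DensityMomentum R T f g m mx v vx) (hR : 0 < R) {t : ℝ}
    (hanti : AntitoneOn (fun x => m x t) (Icc 0 (R / 2))) {y : ℝ} (hy : y ∈ Icc 0 (R / 2)) :
    mx y t ≤ 0 := by
  rw [← (h.hmx y t).hasDerivWithinAt.derivWithin (uniqueDiffOn_Icc (half_pos hR) y hy)]
  exact hanti.derivWithin_nonpos

theorem momentum_massPos_nonpos (h : DensityMomentum R T f g m mx v vx) (hR : 0 < R)
    (hT : 0 < T) (hf : ContinuousOn (deriv f) (Ioi 0)) (hfmono : MonotoneOn f (Ioi 0))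
    (hgmono : MonotoneOn g (Ioi 0)) (hmx : ∀ y ∈ Icc 0 (R / 2), ∀ t ∈ Icc 0 T, mx y t ≤ 0)
    {s t : ℝ} (hs : s ∈ Icc 0 (massTo m (R / 2) 0)) (ht : t ∈ Icc 0 T) :
    v (massPos m s t) t ≤ 0 := by
  have hT' : T ∈ Icc 0 T := right_mem_Icc.2 hT.le
  refine (h.monotoneOn_momentum_massPos hR hT hf hfmono hmx hs ht hT' ht.2).trans ?_
  simp only [h.term]
  exact mul_nonpos_of_nonneg_of_nonpos (deriv_nonneg_of_monotoneOn_Ioi hgmono (h.pos _ _))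
    (hmx _ (h.massPos_mem_Icc hR hT hs) T hT')

/-- Mass is transported along trajectories. -/
theorem trajectory_eq_massPos (h : DensityMomentum R T f g m mx v vx) {γ : ℝ → ℝ}
    (hγ : ∀ t ∈ Icc 0 T, HasDerivAt γ (-v (γ t) t) t) {t : ℝ} (ht : t ∈ Icc 0 T) :
    γ t = massPos m (massTo m (γ 0) 0) t := by
  have := h.cm; have := h.cv
  have hcont : Continuous (Function.uncurry (massTo m)) :=
    intervalIntegral.continuous_parametric_primitive_of_continuous (a₀ := 0)
      (f := fun t x => m x t) (by fun_prop) |>.comp continuous_swap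
  have hγc : ContinuousOn γ (Icc 0 T) := fun t ht => (hγ t ht).continuousAt.continuousWithinAt
  have := eq_initial_of_hasDerivAt_zero (F := fun t => massTo m (γ t) t)
    (hcont.comp_continuousOn (hγc.prodMk continuousOn_id)) (fun t ht => ?_) ht
  · rw [← this, h.massPos_massTo]
  · refine (hasDerivAt_along_curve (Ft := fun y t => m y t * v y t) ht h.cm (by fun_prop)
      h.hasDerivAt_massTo (fun y t ht => h.hasDerivAt_massTo_time y ht)
      (hγ t (Ioo_subset_Icc_self ht))).congr_deriv ?_
    ring

end DensityMomentum

/-- Preservation of monotonicity: if the initial density is even and nonincreasing on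
`[0, R/2]`, and the solution of the terminal-coupling MFG problem is unique, then the
density stays even and nonincreasing on `[0, R/2]` for all times, optimal trajectories
starting in `[0, R/2]` are concave and nondecreasing in time, and `u_x ≤ 0` on
`[0, R/2] × [0,T]`. -/
theorem stmt15
    (R T : ℝ) (hR : 0 < R) (hT : 0 < T)
    (f g : ℝ → ℝ)
    (hf : ContDiffOn ℝ (⊤ : ℕ∞) f (Ioi 0)) (hg : ContDiffOn ℝ (⊤ : ℕ∞) g (Ioi 0))
    (hfmono : MonotoneOn f (Ioi 0)) (hgmono : MonotoneOn g (Ioi 0))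
    (u m : ℝ → ℝ → ℝ)
    (hsol : TermSol R T f g u m)
    (heven0 : ∀ x : ℝ, m (-x) 0 = m x 0)
    (hmono0 : AntitoneOn (fun x => m x 0) (Icc 0 (R/2)))
    (huniq : ∀ u' m' : ℝ → ℝ → ℝ, TermSol R T f g u' m' →
      (∀ x : ℝ, m' x 0 = m x 0) →
      ∀ x t : ℝ, t ∈ Icc 0 T → u' x t = u x t ∧ m' x t = m x t) :
    (∀ t ∈ Icc (0:ℝ) T,
      (∀ x : ℝ, m (-x) t = m x t) ∧ AntitoneOn (fun x => m x t) (Icc 0 (R/2))) ∧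
    (∀ x : ℝ, x ∈ Icc 0 (R/2) → ∀ γ : ℝ → ℝ,
      γ 0 = x →
      (∀ t ∈ Icc (0:ℝ) T, HasDerivAt γ (-(pdx u (γ t) t)) t) →
      ConcaveOn ℝ (Icc 0 T) γ ∧ MonotoneOn γ (Icc 0 T)) ∧
    (∀ x t : ℝ, x ∈ Icc 0 (R/2) → t ∈ Icc 0 T → pdx u x t ≤ 0) := by
  have hf1 : DifferentiableOn ℝ f (Ioi 0) := hf.differentiableOn (by simp)
  have hg1 : DifferentiableOn ℝ g (Ioi 0) := hg.differentiableOn (by simp)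
  have hsym := huniq _ _ hsol.comp_neg heven0
  have ueven : ∀ x, ∀ t ∈ Icc 0 T, u (-x) t = u x t := fun x t ht => (hsym x t ht).1
  have meven : ∀ x, ∀ t ∈ Icc 0 T, m (-x) t = m x t := fun x t ht => (hsym x t ht).2
  have h := hsol.densityMomentum hT hf1 hg1 ueven meven
  have hc0 : max 0 (min 0 T) = 0 := clamp_of_mem (left_mem_Icc.2 hT.le)
  have hf' := continuousOn_deriv_of_smooth hf
  have hanti := fun t ht =>
    h.antitoneOn_density hR hT hf hg hfmono hgmono (by simpa only [hc0] using hmono0) (t := t) ht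
  have hmx := fun y hy t ht => h.mx_nonpos hR (hanti t ht) (y := y) hy
  refine ⟨fun t ht => ⟨fun x => meven x t ht, by simpa only [clamp_of_mem ht] using hanti t ht⟩,
    fun x hx γ hγ0 hγ => ?_, fun x t hx ht => ?_⟩
  · have hs := h.massTo_mem_Icc hT hx (t := 0)
    have hflow : ∀ t ∈ Icc 0 T, γ t = massPos (fun x t => m x (max 0 (min t T)))
        (massTo (fun x t => m x (max 0 (min t T))) x 0) t := fun t ht => by
      rw [← hγ0]
      exact h.trajectory_eq_massPos
        (fun t ht => by simpa only [clamp_of_mem ht] using hγ t ht) ht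
    have hV := h.monotoneOn_momentum_massPos hR hT hf' hfmono hmx hs
    have hcont : ContinuousOn γ (Icc 0 T) := fun t ht =>
      (hγ t ht).continuousAt.continuousWithinAt
    have hdiff : DifferentiableOn ℝ γ (interior (Icc 0 T)) := fun t ht =>
      (hγ t (interior_subset ht)).differentiableAt.differentiableWithinAt
    have hderiv : ∀ t ∈ interior (Icc 0 T), deriv γ t = -pdx u
        (massPos (fun x t => m x (max 0 (min t T)))
          (massTo (fun x t => m x (max 0 (min t T))) x 0) t) (max 0 (min t T)) := fun t ht => by
      have ht' := interior_subset ht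
      rw [(hγ t ht').deriv, ← hflow t ht', clamp_of_mem ht']
    refine ⟨AntitoneOn.concaveOn_of_deriv (convex_Icc 0 T) hcont hdiff fun t₁ ht₁ t₂ ht₂ ht => ?_,
      monotoneOn_of_deriv_nonneg (convex_Icc 0 T) hcont hdiff fun t ht => ?_⟩
    · rw [hderiv t₁ ht₁, hderiv t₂ ht₂]
      exact neg_le_neg (hV (interior_subset ht₁) (interior_subset ht₂) ht)
    · rw [hderiv t ht, neg_nonneg]
      exact h.momentum_massPos_nonpos hR hT hf' hfmono hgmono hmx hs (interior_subset ht)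
  · have := h.momentum_massPos_nonpos hR hT hf' hfmono hgmono hmx
      (h.massTo_mem_Icc hT hx (t := t)) ht
    rwa [h.massPos_massTo, clamp_of_mem ht] at this
end

section
/- Let R ≥ 1, T > 0, and let (u,m) be a classical R-periodic solution on ℝ × [0,T] of the MFG system with entropic coupling: −∂_t u + (1/2)(∂_x u)² = log m, ∂_t m − ∂_x(m·∂_x u) = 0, with u, m C^∞, R-periodic in x, and m > 0. Set K = max( sup_{x∈ℝ} m(x,0), sup_{x∈ℝ} m(x,T) ). Then for every integer p ≥ 1 the map t ↦ ∫_0^R | log( m(x,t)/K ) |^p dx is twice differentiable on (0,T) and its second derivative is nonnegative at every t ∈ (0,T). -/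
open Set Real

/-- The open space-time strip `ℝ × (0,T)`. -/
def openStrip (T : ℝ) : Set (ℝ × ℝ) := {p | p.2 ∈ Ioo 0 T}

/-- Joint smoothness on the open strip. -/
def SmoothOnStrip (T : ℝ) (h : ℝ → ℝ → ℝ) : Prop :=
  ContDiffOn ℝ (⊤ : ℕ∞) (fun p : ℝ × ℝ => h p.1 p.2) (openStrip T)

lemma isOpen_openStrip (T : ℝ) : IsOpen (openStrip T) :=
  isOpen_Ioo.preimage continuous_snd

namespace SmoothOnStrip

variable {T : ℝ} {h : ℝ → ℝ → ℝ}

lemma differentiableAt (hh : SmoothOnStrip T h) {x t : ℝ} (ht : t ∈ Ioo 0 T) :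
    DifferentiableAt ℝ (fun p : ℝ × ℝ => h p.1 p.2) (x, t) :=
  (hh.contDiffAt ((isOpen_openStrip T).mem_nhds ht)).differentiableAt (by simp)

lemma hasDerivAt_fst (hh : SmoothOnStrip T h) {x t : ℝ} (ht : t ∈ Ioo 0 T) :
    HasDerivAt (fun y => h y t) (fderiv ℝ (fun p : ℝ × ℝ => h p.1 p.2) (x, t) (1, 0)) x :=
  (hh.differentiableAt ht).hasFDerivAt.comp_hasDerivAt (f := fun y => (y, t)) x
    ((hasDerivAt_id' x).prodMk (hasDerivAt_const x t))

lemma hasDerivAt_snd (hh : SmoothOnStrip T h) {x t : ℝ} (ht : t ∈ Ioo 0 T) :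
    HasDerivAt (fun s => h x s) (fderiv ℝ (fun p : ℝ × ℝ => h p.1 p.2) (x, t) (0, 1)) t :=
  (hh.differentiableAt ht).hasFDerivAt.comp_hasDerivAt (f := fun s => (x, s)) t
    ((hasDerivAt_const t x).prodMk (hasDerivAt_id' t))

lemma pdx_eq (hh : SmoothOnStrip T h) {x t : ℝ} (ht : t ∈ Ioo 0 T) :
    pdx h x t = fderiv ℝ (fun p : ℝ × ℝ => h p.1 p.2) (x, t) (1, 0) :=
  (hh.hasDerivAt_fst ht).deriv

lemma pdt_eq (hh : SmoothOnStrip T h) {x t : ℝ} (ht : t ∈ Ioo 0 T) :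
    pdt h x t = fderiv ℝ (fun p : ℝ × ℝ => h p.1 p.2) (x, t) (0, 1) :=
  (hh.hasDerivAt_snd ht).deriv

lemma hasDerivAt_pdx (hh : SmoothOnStrip T h) {x t : ℝ} (ht : t ∈ Ioo 0 T) :
    HasDerivAt (fun y => h y t) (_root_.pdx h x t) x :=
  hh.pdx_eq ht ▸ hh.hasDerivAt_fst ht

lemma hasDerivAt_pdt (hh : SmoothOnStrip T h) {x t : ℝ} (ht : t ∈ Ioo 0 T) :
    HasDerivAt (fun s => h x s) (_root_.pdt h x t) t :=
  hh.pdt_eq ht ▸ hh.hasDerivAt_snd ht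

lemma fderiv_apply (hh : SmoothOnStrip T h) (w : ℝ × ℝ) :
    SmoothOnStrip T fun x t => fderiv ℝ (fun p : ℝ × ℝ => h p.1 p.2) (x, t) w :=
  (ContDiffOn.fderiv_of_isOpen hh (isOpen_openStrip T) le_rfl).clm_apply contDiffOn_const

lemma pdx (hh : SmoothOnStrip T h) : SmoothOnStrip T (pdx h) :=
  (hh.fderiv_apply (1, 0)).congr fun _ hp => hh.pdx_eq hp

lemma pdt (hh : SmoothOnStrip T h) : SmoothOnStrip T (pdt h) :=
  (hh.fderiv_apply (0, 1)).congr fun _ hp => hh.pdt_eq hp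

lemma fderiv_fderiv_apply (hh : SmoothOnStrip T h) (v w : ℝ × ℝ) {x t : ℝ} (ht : t ∈ Ioo 0 T) :
    fderiv ℝ (fun p : ℝ × ℝ => fderiv ℝ (fun p : ℝ × ℝ => h p.1 p.2) (p.1, p.2) v) (x, t) w =
      fderiv ℝ (fderiv ℝ (fun p : ℝ × ℝ => h p.1 p.2)) (x, t) w v := by
  have hd : DifferentiableAt ℝ (fderiv ℝ (fun p : ℝ × ℝ => h p.1 p.2)) (x, t) :=
    ((ContDiffOn.fderiv_of_isOpen (m := (⊤ : ℕ∞)) hh (isOpen_openStrip T) le_rfl).contDiffAt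
      ((isOpen_openStrip T).mem_nhds ht)).differentiableAt (by simp)
  have := (hd.hasFDerivAt.clm_apply (hasFDerivAt_const v (x, t))).fderiv
  simpa using congrArg (fun A => A w) this

lemma pdx_pdt (hh : SmoothOnStrip T h) {x t : ℝ} (ht : t ∈ Ioo 0 T) :
    _root_.pdx (_root_.pdt h) x t = _root_.pdt (_root_.pdx h) x t := by
  have hx : _root_.pdx (_root_.pdt h) x t =
      _root_.pdx (fun x t => fderiv ℝ (fun p : ℝ × ℝ => h p.1 p.2) (x, t) (0, 1)) x t := by
    unfold _root_.pdx
    congr 1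
    funext y
    exact hh.pdt_eq ht
  have ht' : _root_.pdt (_root_.pdx h) x t =
      _root_.pdt (fun x t => fderiv ℝ (fun p : ℝ × ℝ => h p.1 p.2) (x, t) (1, 0)) x t := by
    unfold _root_.pdt
    apply Filter.EventuallyEq.deriv_eq
    filter_upwards [isOpen_Ioo.mem_nhds ht] with s hs using hh.pdx_eq hs
  rw [hx, ht', (hh.fderiv_apply _).pdx_eq ht, (hh.fderiv_apply _).pdt_eq ht,
    hh.fderiv_fderiv_apply _ _ ht, hh.fderiv_fderiv_apply _ _ ht]
  exact ((hh.contDiffAt ((isOpen_openStrip T).mem_nhds ht)).isSymmSndFDerivAt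
    (by simp; exact WithTop.coe_le_coe.mpr le_top)).eq _ _

lemma continuousOn (hh : SmoothOnStrip T h) :
    ContinuousOn (fun p : ℝ × ℝ => h p.1 p.2) (openStrip T) :=
  ContDiffOn.continuousOn hh

lemma pdt_periodic {R : ℝ} (hper : ∀ x, ∀ t ∈ Ioo 0 T, h (x + R) t = h x t) {x t : ℝ}
    (ht : t ∈ Ioo 0 T) : _root_.pdt h (x + R) t = _root_.pdt h x t := by
  unfold _root_.pdt
  apply Filter.EventuallyEq.deriv_eq
  filter_upwards [isOpen_Ioo.mem_nhds ht] with s hs using hper x s hs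

lemma pdx_periodic {R : ℝ} (hper : ∀ x, ∀ t ∈ Ioo 0 T, h (x + R) t = h x t) {x t : ℝ}
    (ht : t ∈ Ioo 0 T) : _root_.pdx h (x + R) t = _root_.pdx h x t := by
  unfold _root_.pdx
  rw [← deriv_comp_add_const]
  congr 1
  funext y
  exact hper y t ht

end SmoothOnStrip

lemma continuous_slice {T : ℝ} {F : ℝ → ℝ → ℝ}
    (hF : ContinuousOn (fun p : ℝ × ℝ => F p.1 p.2) (openStrip T)) {t : ℝ} (ht : t ∈ Ioo 0 T) :
    Continuous fun x => F x t :=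
  hF.comp_continuous (f := fun x : ℝ => (x, t)) (by fun_prop) fun _ => ht

/-- Differentiation under the integral sign over a compact space interval. -/
lemma hasDerivAt_intervalIntegral_strip {R T : ℝ} {F F' : ℝ → ℝ → ℝ}
    (hF : ContinuousOn (fun p : ℝ × ℝ => F p.1 p.2) (openStrip T))
    (hF' : ContinuousOn (fun p : ℝ × ℝ => F' p.1 p.2) (openStrip T))
    (hd : ∀ x, ∀ t ∈ Ioo 0 T, HasDerivAt (fun s => F x s) (F' x t) t)
    {t : ℝ} (ht : t ∈ Ioo 0 T) :
    HasDerivAt (fun s => ∫ x in (0:ℝ)..R, F x s) (∫ x in (0:ℝ)..R, F' x t) t := by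
  obtain ⟨a, b, htab, hnhds, hab⟩ := exists_Icc_mem_subset_of_mem_nhds (isOpen_Ioo.mem_nhds ht)
  obtain ⟨C, hC⟩ := (isCompact_uIcc.prod isCompact_Icc).exists_bound_of_continuousOn
    (hF'.mono fun p (hp : p ∈ uIcc 0 R ×ˢ Icc a b) => hab hp.2)
  refine (intervalIntegral.hasDerivAt_integral_of_dominated_loc_of_deriv_le
    (F := fun s x => F x s) (F' := fun s x => F' x s) (bound := fun _ => C) hnhds ?_ ?_ ?_ ?_ ?_ ?_).2
  · filter_upwards [isOpen_Ioo.mem_nhds ht] with s hs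
    exact (continuous_slice hF hs).aestronglyMeasurable
  · exact (continuous_slice hF ht).intervalIntegrable _ _
  · exact (continuous_slice hF' ht).aestronglyMeasurable
  · exact .of_forall fun x hx s hs => hC (x, s) ⟨uIoc_subset_uIcc hx, hs⟩
  · exact intervalIntegrable_const
  · exact .of_forall fun x _ s hs => hd x s (hab hs)

lemma integral_eq_of_sub_hasDerivAt {R : ℝ} {a b G : ℝ → ℝ} (ha : Continuous a)
    (hb : Continuous b) (hG : ∀ x, HasDerivAt G (a x - b x) x) (hper : G R = G 0) :
    ∫ x in (0:ℝ)..R, a x = ∫ x in (0:ℝ)..R, b x := by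
  rw [← sub_eq_zero, ← intervalIntegral.integral_sub (ha.intervalIntegrable _ _)
    (hb.intervalIntegrable _ _), intervalIntegral.integral_eq_sub_of_hasDerivAt
    (fun x _ => hG x) ((ha.sub hb).intervalIntegrable _ _), hper, sub_self]

/-- The first-order system solved by `L = log m` and `v = ∂ₓu` for the entropic coupling. -/
structure IsLogFlow (R T : ℝ) (L v : ℝ → ℝ → ℝ) : Prop where
  smooth_L : SmoothOnStrip T L
  smooth_v : SmoothOnStrip T v
  periodic_L : ∀ x, ∀ t ∈ Ioo 0 T, L (x + R) t = L x t
  periodic_v : ∀ x, ∀ t ∈ Ioo 0 T, v (x + R) t = v x t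
  pdt_L : ∀ x, ∀ t ∈ Ioo 0 T, pdt L x t = v x t * pdx L x t + pdx v x t
  pdt_v : ∀ x, ∀ t ∈ Ioo 0 T, pdt v x t = v x t * pdx v x t - pdx L x t

namespace IsLogFlow

variable {R T : ℝ} {L v : ℝ → ℝ → ℝ}

lemma hasDerivAt_integral (H : IsLogFlow R T L v) {f f' : ℝ → ℝ}
    (hf : ∀ s, HasDerivAt f (f' s) s) (hf' : Continuous f') {t : ℝ} (ht : t ∈ Ioo 0 T) :
    HasDerivAt (fun s => ∫ x in (0:ℝ)..R, f (L x s))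
      (∫ x in (0:ℝ)..R, (f' (L x t) - f (L x t)) * pdx v x t) t := by
  have hfc : Continuous f := continuous_iff_continuousAt.2 fun s => (hf s).continuousAt
  have cL := H.smooth_L.continuousOn
  have cLt := H.smooth_L.pdt.continuousOn
  have cvx := H.smooth_v.pdx.continuousOn
  have c1 := (hf'.comp_continuousOn cL).mul cLt
  have c2 := ((hf'.comp_continuousOn cL).sub (hfc.comp_continuousOn cL)).mul cvx
  have key := hasDerivAt_intervalIntegral_strip (R := R) (F := fun x s => f (L x s))
    (F' := fun x s => f' (L x s) * pdt L x s) (hfc.comp_continuousOn cL) c1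
    (fun x s hs => (hf _).comp s (H.smooth_L.hasDerivAt_pdt hs)) ht
  refine key.congr_deriv (integral_eq_of_sub_hasDerivAt (G := fun x => f (L x t) * v x t)
    (continuous_slice (F := fun x s => f' (L x s) * pdt L x s) c1 ht)
    (continuous_slice (F := fun x s => (f' (L x s) - f (L x s)) * pdx v x s) c2 ht)
    (fun x => ?_) ?_)
  · refine (((hf _).comp x (H.smooth_L.hasDerivAt_pdx ht)).mul
      (H.smooth_v.hasDerivAt_pdx ht)).congr_deriv ?_
    simp only [H.pdt_L x t ht, Function.comp_apply]
    ring
  · have h1 := H.periodic_L 0 t ht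
    have h2 := H.periodic_v 0 t ht
    simp only [zero_add] at h1 h2
    simp only [h1, h2]

lemma hasDerivAt_integral_mul_pdx (H : IsLogFlow R T L v) {g g' : ℝ → ℝ}
    (hg : ∀ s, HasDerivAt g (g' s) s) (hg' : Continuous g') {t : ℝ} (ht : t ∈ Ioo 0 T) :
    HasDerivAt (fun s => ∫ x in (0:ℝ)..R, g (L x s) * pdx v x s)
      (∫ x in (0:ℝ)..R, g' (L x t) * (pdx v x t ^ 2 + pdx L x t ^ 2)) t := by
  have hgc : Continuous g := continuous_iff_continuousAt.2 fun s => (hg s).continuousAt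
  have cL := H.smooth_L.continuousOn
  have cLt := H.smooth_L.pdt.continuousOn
  have cLx := H.smooth_L.pdx.continuousOn
  have cvx := H.smooth_v.pdx.continuousOn
  have cvxt := H.smooth_v.pdx.pdt.continuousOn
  have c1 := (((hg'.comp_continuousOn cL).mul cLt).mul cvx).add
    ((hgc.comp_continuousOn cL).mul cvxt)
  have c2 := (hg'.comp_continuousOn cL).mul ((cvx.pow 2).add (cLx.pow 2))
  have key := hasDerivAt_intervalIntegral_strip (R := R) (F := fun x s => g (L x s) * pdx v x s)
    (F' := fun x s => g' (L x s) * pdt L x s * pdx v x s + g (L x s) * pdt (pdx v) x s)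
    ((hgc.comp_continuousOn cL).mul cvx) c1
    (fun x s hs => ((hg _).comp s (H.smooth_L.hasDerivAt_pdt hs)).mul
      (H.smooth_v.pdx.hasDerivAt_pdt hs)) ht
  refine key.congr_deriv (integral_eq_of_sub_hasDerivAt (G := fun x => g (L x t) * pdt v x t)
    (continuous_slice (F := fun x s => g' (L x s) * pdt L x s * pdx v x s
      + g (L x s) * pdt (pdx v) x s) c1 ht)
    (continuous_slice (F := fun x s => g' (L x s) * (pdx v x s ^ 2 + pdx L x s ^ 2)) c2 ht)
    (fun x => ?_) ?_)
  · refine (((hg _).comp x (H.smooth_L.hasDerivAt_pdx ht)).mul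
      (H.smooth_v.pdt.hasDerivAt_pdx ht)).congr_deriv ?_
    simp only [H.pdt_L x t ht, H.smooth_v.pdx_pdt ht, H.pdt_v x t ht, Function.comp_apply]
    ring
  · have h1 := H.periodic_L 0 t ht
    have h2 := SmoothOnStrip.pdt_periodic H.periodic_v (x := 0) ht
    simp only [zero_add] at h1 h2
    simp only [h1, h2]

/-- Displacement convexity: `t ↦ ∫ f(L)` has nonnegative second derivative when `f' ≤ f''` on the
range of `L`. -/
theorem deriv_deriv_integral_nonneg (H : IsLogFlow R T L v) (hR : 0 ≤ R) {f f' f'' : ℝ → ℝ}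
    (hf : ∀ s, HasDerivAt f (f' s) s) (hf' : ∀ s, HasDerivAt f' (f'' s) s)
    (hf'' : Continuous f'') (hle : ∀ x ∈ Icc 0 R, ∀ t ∈ Ioo 0 T, f' (L x t) ≤ f'' (L x t))
    {t : ℝ} (ht : t ∈ Ioo 0 T) :
    DifferentiableAt ℝ (fun s => ∫ x in (0:ℝ)..R, f (L x s)) t ∧
      DifferentiableAt ℝ (deriv fun s => ∫ x in (0:ℝ)..R, f (L x s)) t ∧
      0 ≤ deriv (deriv fun s => ∫ x in (0:ℝ)..R, f (L x s)) t := by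
  have hf'c : Continuous f' := continuous_iff_continuousAt.2 fun s => (hf' s).continuousAt
  have hderiv : (deriv fun s => ∫ x in (0:ℝ)..R, f (L x s)) =ᶠ[nhds t]
      fun s => ∫ x in (0:ℝ)..R, (f' (L x s) - f (L x s)) * pdx v x s := by
    filter_upwards [isOpen_Ioo.mem_nhds ht] with s hs using
      (H.hasDerivAt_integral hf hf'c hs).deriv
  have h2 := (H.hasDerivAt_integral_mul_pdx (g := fun s => f' s - f s)
    (fun s => (hf' s).sub (hf s)) (hf''.sub hf'c) ht).congr_of_eventuallyEq hderiv
  refine ⟨(H.hasDerivAt_integral hf hf'c ht).differentiableAt, h2.differentiableAt, ?_⟩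
  rw [h2.deriv]
  refine intervalIntegral.integral_nonneg hR fun x hx => ?_
  exact mul_nonneg (sub_nonneg.2 (hle x hx t ht)) (by positivity)

end IsLogFlow

lemma hasDerivAt_max_zero_pow (n : ℕ) (x : ℝ) :
    HasDerivAt (fun s : ℝ => max s 0 ^ (n + 2)) ((n + 2) * max x 0 ^ (n + 1)) x := by
  rcases lt_trichotomy x 0 with hx | rfl | hx
  · have h : (fun s : ℝ => max s 0 ^ (n + 2)) =ᶠ[nhds x] fun _ => 0 := by
      filter_upwards [Iio_mem_nhds hx] with s hs
      simp [max_eq_right (mem_Iio.1 hs).le]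
    refine ((hasDerivAt_const x (0:ℝ)).congr_of_eventuallyEq h).congr_deriv ?_
    simp [max_eq_right hx.le]
  · rw [hasDerivAt_iff_isLittleO]
    have h : (fun s : ℝ => max s 0 ^ (n + 2)) =O[nhds 0] fun s : ℝ => s ^ (n + 2) := by
      refine Asymptotics.IsBigO.of_bound 1 (.of_forall fun s => ?_)
      rw [one_mul, norm_pow, norm_pow]
      gcongr
      rw [Real.norm_eq_abs, Real.norm_eq_abs, abs_of_nonneg (le_max_right _ _)]
      exact max_le (le_abs_self s) (abs_nonneg s)
    simpa using h.trans_isLittleO (Asymptotics.isLittleO_pow_id (by omega))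
  · have h : (fun s : ℝ => max s 0 ^ (n + 2)) =ᶠ[nhds x] fun s => s ^ (n + 2) := by
      filter_upwards [Ioi_mem_nhds hx] with s hs
      rw [max_eq_left (mem_Ioi.1 hs).le]
    refine ((hasDerivAt_pow (n + 2) x).congr_of_eventuallyEq h).congr_deriv ?_
    rw [max_eq_left hx.le]
    push_cast
    rfl

lemma continuousOn_integral_of_continuousOn_strip {R T : ℝ} (hT : 0 ≤ T) {F : ℝ → ℝ → ℝ}
    (hF : ContinuousOn (fun p : ℝ × ℝ => F p.1 p.2) {p : ℝ × ℝ | p.2 ∈ Icc 0 T}) :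
    ContinuousOn (fun s => ∫ x in (0:ℝ)..R, F x s) (Icc 0 T) := by
  have hc : Continuous (Function.uncurry fun s x : ℝ => F x (projIcc 0 T hT s)) :=
    hF.comp_continuous (f := fun p : ℝ × ℝ => (p.2, (projIcc 0 T hT p.1 : ℝ)))
      (by fun_prop) fun p => (projIcc 0 T hT p.1).2
  refine (intervalIntegral.continuous_parametric_intervalIntegral_of_continuous' hc 0 R
    (μ := MeasureTheory.volume)).continuousOn.congr fun s hs => ?_
  simp only [projIcc_of_mem hT hs]

/-- Maximum principle: the density is bounded by its initial and terminal bounds. -/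
lemma IsLogFlow.le_of_boundary {R T K : ℝ} {m v : ℝ → ℝ → ℝ}
    (H : IsLogFlow R T (fun x t => Real.log (m x t)) v) (hR : 0 < R) (hT : 0 < T)
    (hm : ContinuousOn (fun p : ℝ × ℝ => m p.1 p.2) {p : ℝ × ℝ | p.2 ∈ Icc 0 T})
    (hpos : ∀ x, ∀ t ∈ Icc 0 T, 0 < m x t) (h0 : ∀ x, m x 0 ≤ K) (h1 : ∀ x, m x T ≤ K)
    {x t : ℝ} (hx : x ∈ Icc 0 R) (ht : t ∈ Icc 0 T) : m x t ≤ K := by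
  set f : ℝ → ℝ := fun s => max (Real.exp s - K) 0 ^ 3 with hf
  have hd : ∀ n : ℕ, ∀ s, HasDerivAt (fun s : ℝ => max (Real.exp s - K) 0 ^ (n + 2))
      ((n + 2) * max (Real.exp s - K) 0 ^ (n + 1) * Real.exp s) s := fun n s =>
    (hasDerivAt_max_zero_pow n _).comp s ((Real.hasDerivAt_exp s).sub_const K)
  have hf1 : ∀ s, HasDerivAt f (3 * max (Real.exp s - K) 0 ^ 2 * Real.exp s) s := fun s =>
    (hd 1 s).congr_deriv (by norm_num)
  have hf2 : ∀ s, HasDerivAt (fun s => 3 * max (Real.exp s - K) 0 ^ 2 * Real.exp s)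
      (6 * max (Real.exp s - K) 0 * Real.exp s ^ 2
        + 3 * max (Real.exp s - K) 0 ^ 2 * Real.exp s) s := fun s =>
    ((((hd 0 s).const_mul 3).mul (Real.hasDerivAt_exp s))).congr_deriv (by norm_num; ring)
  have hexp : ∀ x, ∀ t ∈ Icc 0 T, f (Real.log (m x t)) = max (m x t - K) 0 ^ 3 := fun x t ht => by
    simp only [hf, Real.exp_log (hpos x t ht)]
  have hcont : ContinuousOn (fun p : ℝ × ℝ => f (Real.log (m p.1 p.2)))
      {p : ℝ × ℝ | p.2 ∈ Icc 0 T} :=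
    ((hm.sub continuousOn_const).sup continuousOn_const |>.pow 3).congr fun p hp => hexp _ _ hp
  have hcvx : ConvexOn ℝ (Icc 0 T) fun s => ∫ x in (0:ℝ)..R, f (Real.log (m x s)) := by
    have D : ∀ s ∈ Ioo 0 T, _ := fun s hs =>
      H.deriv_deriv_integral_nonneg hR.le hf1 hf2 (by fun_prop)
        (fun x _ t _ => le_add_of_nonneg_left (by positivity)) hs
    apply convexOn_of_deriv2_nonneg (convex_Icc 0 T)
      (continuousOn_integral_of_continuousOn_strip (F := fun x s => f (Real.log (m x s)))
        hT.le hcont)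
    all_goals rw [interior_Icc]
    · exact fun s hs => (D s hs).1.differentiableWithinAt
    · exact fun s hs => (D s hs).2.1.differentiableWithinAt
    · exact fun s hs => (D s hs).2.2
  have hzero : ∀ s ∈ Icc 0 T, (∀ x, m x s ≤ K) →
      ∫ x in (0:ℝ)..R, f (Real.log (m x s)) = 0 := fun s hs hK => by
    simp [hexp _ s hs, max_eq_right (sub_nonpos.2 (hK _))]
  have hle := hcvx.le_max_of_mem_Icc (left_mem_Icc.2 hT.le) (right_mem_Icc.2 hT.le) ht
  rw [hzero 0 (left_mem_Icc.2 hT.le) h0, hzero T (right_mem_Icc.2 hT.le) h1, max_self] at hle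
  by_contra! hlt
  refine hle.not_gt (intervalIntegral.integral_pos hR ?_ (fun y _ => by positivity) ⟨x, hx, ?_⟩)
  · exact (hcont.comp_continuous (f := fun x : ℝ => (x, t)) (by fun_prop)
      fun _ => ht).continuousOn
  · rw [hexp x t ht]
    exact pow_pos (lt_max_of_lt_left (sub_pos.2 hlt)) 3

lemma isLogFlow_of_mfg {R T : ℝ} {u m : ℝ → ℝ → ℝ} (hu : SmoothOnStrip T u)
    (hm : SmoothOnStrip T m)
    (huper : ∀ x, ∀ t ∈ Ioo 0 T, u (x + R) t = u x t)
    (hmper : ∀ x, ∀ t ∈ Ioo 0 T, m (x + R) t = m x t)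
    (hmpos : ∀ x, ∀ t ∈ Ioo 0 T, 0 < m x t)
    (hHJ : ∀ x, ∀ t ∈ Ioo 0 T, -pdt u x t + (1/2) * (pdx u x t)^2 = Real.log (m x t))
    (hCE : ∀ x, ∀ t ∈ Ioo 0 T, pdt m x t - pdx (fun y s => m y s * pdx u y s) x t = 0) :
    IsLogFlow R T (fun x t => Real.log (m x t)) (pdx u) where
  smooth_L := ContDiffOn.log hm fun p hp => (hmpos _ _ hp).ne'
  smooth_v := hu.pdx
  periodic_L x t ht := by rw [hmper x t ht]
  periodic_v x t ht := SmoothOnStrip.pdx_periodic huper ht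
  pdt_L x t ht := by
    have ht1 := ((hm.hasDerivAt_pdt (x := x) ht).log (hmpos x t ht).ne').deriv
    have hx1 := ((hm.hasDerivAt_pdx (x := x) ht).log (hmpos x t ht).ne').deriv
    have h2 := ((hm.hasDerivAt_pdx (x := x) ht).mul (hu.pdx.hasDerivAt_pdx ht)).deriv
    have h3 : pdt m x t = pdx m x t * pdx u x t + m x t * pdx (pdx u) x t :=
      (sub_eq_zero.1 (hCE x t ht)).trans h2
    change deriv _ _ = _ * deriv _ _ + _
    have := (hmpos x t ht).ne'
    rw [ht1, hx1, h3]
    field_simp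
  pdt_v x t ht := by
    rw [← hu.pdx_pdt ht]
    have h : (fun y => pdt u y t) = fun y => (1/2) * (pdx u y t)^2 - Real.log (m y t) := by
      funext y
      linarith [hHJ y t ht]
    have hL := (hm.hasDerivAt_pdx (x := x) ht).log (hmpos x t ht).ne'
    have hd := (((hu.pdx.hasDerivAt_pdx (x := x) ht).pow 2).const_mul (1/2)).sub hL
    change deriv (fun y => pdt u y t) x = _ - deriv _ _
    rw [h, hL.deriv]
    refine hd.deriv.trans ?_
    norm_num
    ring

lemma bddAbove_range_of_periodic {R : ℝ} (hR : R ≠ 0) {g : ℝ → ℝ} (hg : Continuous g)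
    (hper : ∀ x, g (x + R) = g x) : BddAbove (range g) :=
  (Function.Periodic.isBounded_of_continuous hper hR hg).bddAbove

/-- Convexity in time of the `L^p` norms of `log(m/K)` for the entropic coupling: with
`K = max(sup m(·,0), sup m(·,T))`, for every integer `p ≥ 1` the map
`t ↦ ∫₀ᴿ |log(m(x,t)/K)|^p dx` is twice differentiable on `(0,T)` with nonnegative second
derivative. -/
theorem stmt16
    (R T : ℝ) (hR : 1 ≤ R) (hT : 0 < T)
    (u m : ℝ → ℝ → ℝ)
    (hu : ContDiffOn ℝ (⊤ : ℕ∞) (fun p : ℝ × ℝ => u p.1 p.2) {p : ℝ × ℝ | p.2 ∈ Icc 0 T})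
    (hm : ContDiffOn ℝ (⊤ : ℕ∞) (fun p : ℝ × ℝ => m p.1 p.2) {p : ℝ × ℝ | p.2 ∈ Icc 0 T})
    (huper : ∀ x t : ℝ, t ∈ Icc 0 T → u (x + R) t = u x t)
    (hmper : ∀ x t : ℝ, t ∈ Icc 0 T → m (x + R) t = m x t)
    (hmpos : ∀ x t : ℝ, t ∈ Icc 0 T → 0 < m x t)
    (hHJ : ∀ x t : ℝ, t ∈ Icc 0 T →
      -pdt u x t + (1/2) * (pdx u x t)^2 = Real.log (m x t))
    (hCE : ∀ x t : ℝ, t ∈ Icc 0 T →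
      pdt m x t - pdx (fun y s => m y s * pdx u y s) x t = 0) :
    ∀ p : ℕ, 1 ≤ p → ∀ t ∈ Ioo (0:ℝ) T,
      DifferentiableAt ℝ
        (fun s => ∫ x in (0:ℝ)..R,
          |Real.log (m x s / max (⨆ y : ℝ, m y 0) (⨆ y : ℝ, m y T))| ^ p) t ∧
      DifferentiableAt ℝ
        (deriv (fun s => ∫ x in (0:ℝ)..R,
          |Real.log (m x s / max (⨆ y : ℝ, m y 0) (⨆ y : ℝ, m y T))| ^ p)) t ∧
      0 ≤ deriv (deriv (fun s => ∫ x in (0:ℝ)..R,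
          |Real.log (m x s / max (⨆ y : ℝ, m y 0) (⨆ y : ℝ, m y T))| ^ p)) t := by
  intro p hp
  set K := max (⨆ y : ℝ, m y 0) (⨆ y : ℝ, m y T) with hK
  have hslice : ∀ t ∈ Icc 0 T, Continuous fun x => m x t := fun t ht =>
    hm.continuousOn.comp_continuous (f := fun x : ℝ => (x, t)) (by fun_prop) fun _ => ht
  have hbdd : ∀ t ∈ Icc 0 T, BddAbove (range fun x => m x t) := fun t ht =>
    bddAbove_range_of_periodic (by positivity) (hslice t ht) fun x => hmper x t ht
  have h0T : (0:ℝ) ∈ Icc 0 T := left_mem_Icc.2 hT.le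
  have hTT : T ∈ Icc 0 T := right_mem_Icc.2 hT.le
  have h0 : ∀ x, m x 0 ≤ K := fun x => (le_ciSup (hbdd 0 h0T) x).trans (le_max_left _ _)
  have h1 : ∀ x, m x T ≤ K := fun x => (le_ciSup (hbdd T hTT) x).trans (le_max_right _ _)
  have hKpos : 0 < K := (hmpos 0 0 h0T).trans_le (h0 0)
  have hsub : openStrip T ⊆ {p : ℝ × ℝ | p.2 ∈ Icc 0 T} := fun p hp => Ioo_subset_Icc_self hp
  have H : IsLogFlow R T (fun x t => Real.log (m x t)) (pdx u) :=
    isLogFlow_of_mfg (hu.mono hsub) (hm.mono hsub)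
      (fun x t ht => huper x t (Ioo_subset_Icc_self ht))
      (fun x t ht => hmper x t (Ioo_subset_Icc_self ht))
      (fun x t ht => hmpos x t (Ioo_subset_Icc_self ht))
      (fun x t ht => hHJ x t (Ioo_subset_Icc_self ht))
      (fun x t ht => hCE x t (Ioo_subset_Icc_self ht))
  have hlog : ∀ x ∈ Icc 0 R, ∀ t ∈ Ioo 0 T, 0 ≤ Real.log K - Real.log (m x t) :=
    fun x hx t ht => sub_nonneg.2 <| Real.log_le_log (hmpos x t (Ioo_subset_Icc_self ht)) <|
      H.le_of_boundary (by positivity) hT hm.continuousOn hmpos h0 h1 hx (Ioo_subset_Icc_self ht)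
  have heq : ∀ t ∈ Ioo 0 T, ∫ x in (0:ℝ)..R, |Real.log (m x t / K)| ^ p =
      ∫ x in (0:ℝ)..R, (Real.log K - Real.log (m x t)) ^ p := fun t ht => by
    refine intervalIntegral.integral_congr fun x hx => ?_
    rw [uIcc_of_le (by positivity)] at hx
    simp only [Real.log_div (hmpos x t (Ioo_subset_Icc_self ht)).ne' hKpos.ne']
    rw [abs_sub_comm, abs_of_nonneg (hlog x hx t ht)]
  have hd : ∀ n : ℕ, ∀ s, HasDerivAt (fun s : ℝ => (Real.log K - s) ^ n)
      (-(n * (Real.log K - s) ^ (n - 1))) s := fun n s => by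
    have := (((hasDerivAt_id s).const_sub (Real.log K)).pow n)
    simp only [id, mul_neg, mul_one] at this
    exact this
  intro t ht
  have hev : (fun s => ∫ x in (0:ℝ)..R, |Real.log (m x s / K)| ^ p) =ᶠ[nhds t]
      fun s => ∫ x in (0:ℝ)..R, (Real.log K - Real.log (m x s)) ^ p := by
    filter_upwards [isOpen_Ioo.mem_nhds ht] with s hs using heq s hs
  obtain ⟨d1, d2, d3⟩ := H.deriv_deriv_integral_nonneg (by positivity) (hd p)
    (f'' := fun s => p * ((p - 1 : ℕ) * (Real.log K - s) ^ (p - 1 - 1)))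
    (fun s => (((hd (p - 1) s).const_mul (p : ℝ)).neg).congr_deriv (by ring)) (by fun_prop)
    (fun x hx t ht => by
      have := hlog x hx t ht
      exact (neg_nonpos.2 (by positivity)).trans (by positivity)) ht
  refine ⟨d1.congr_of_eventuallyEq hev, d2.congr_of_eventuallyEq hev.deriv, ?_⟩
  rwa [hev.deriv.deriv_eq]
end

section
/- Let θ > 0, ᾱ = 2/(2+θ), R > 0, and let m be the self-similar density m(x,t) = t^{−ᾱ}·( R − (ᾱ(1−ᾱ)/2)·(x/t^ᾱ)² )₊^{1/θ}. Let c : (0,∞) → ℝ be differentiable with c'(t) = −R·t^{−ᾱθ} (note ᾱθ = 2θ/(2+θ)), and define u(x,t) = −ᾱ·x²/(2t) + c(t) for t > 0. Then for every (x,t) with t > 0 and m(x,t) > 0 one has −∂_t u(x,t) + (1/2)·(∂_x u(x,t))² = m(x,t)^θ. -/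
open Real

/-- The self-similar pair solves the Hamilton–Jacobi equation inside the support of the
density: with `ᾱ = 2/(2+θ)`, `m(x,t) = t^{-ᾱ} (R - (ᾱ(1-ᾱ)/2)(x/t^ᾱ)²)₊^{1/θ}`,
`u(x,t) = -ᾱ x²/(2t) + c(t)` and `c'(t) = -R t^{-ᾱθ}`, one has
`-u_t + (1/2) u_x² = m^θ` wherever `t > 0` and `m(x,t) > 0`. -/
theorem stmt17
    (θ ᾱ R : ℝ) (hθ : 0 < θ) (hᾱ : ᾱ = 2 / (2 + θ)) (hR : 0 < R)
    (m : ℝ → ℝ → ℝ)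
    (hm : ∀ x t : ℝ, m x t =
      t ^ (-ᾱ) * (max (R - (ᾱ * (1 - ᾱ) / 2) * (x / t ^ ᾱ)^2) 0) ^ (1/θ))
    (c : ℝ → ℝ)
    (hc : ∀ t : ℝ, 0 < t → HasDerivAt c (-R * t ^ (-(ᾱ * θ))) t)
    (u : ℝ → ℝ → ℝ)
    (hu : ∀ x t : ℝ, u x t = -ᾱ * x^2 / (2 * t) + c t) :
    ∀ x t : ℝ, 0 < t → 0 < m x t →
      -pdt u x t + (1/2) * (pdx u x t)^2 = (m x t) ^ θ := by
  intro x t ht hmpos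
  have hx : pdx u x t = -ᾱ * x / t := by
    have h : HasDerivAt (fun y => u y t) (-ᾱ * (2 * x) / (2 * t)) x := by
      simp only [hu]
      simpa using (((hasDerivAt_pow 2 x).const_mul (-ᾱ)).div_const (2 * t)).add_const (c t)
    rw [pdx, h.deriv]
    field_simp
  have ht' : pdt u x t = ᾱ * x ^ 2 / (2 * t ^ 2) - R * t ^ (-(ᾱ * θ)) := by
    have h : HasDerivAt (fun s => u x s)
        (-ᾱ * x ^ 2 / 2 * (-(t ^ 2)⁻¹) + -R * t ^ (-(ᾱ * θ))) t := by
      have he : (fun s => u x s) = fun s => -ᾱ * x ^ 2 / 2 * s⁻¹ + c s := by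
        funext s
        rw [hu, ← div_div, div_eq_mul_inv _ s]
      rw [he]
      exact ((hasDerivAt_inv ht.ne').const_mul _).add (hc t ht)
    rw [pdt, h.deriv]
    field_simp
    ring
  have hpos : 0 < R - (ᾱ * (1 - ᾱ) / 2) * (x / t ^ ᾱ) ^ 2 := by
    by_contra! hle
    rw [hm, max_eq_right hle, Real.zero_rpow (one_div_pos.mpr hθ).ne', mul_zero] at hmpos
    exact hmpos.false
  have hexp : t ^ (-(ᾱ * θ)) = (t ^ ᾱ) ^ 2 / t ^ 2 := by
    have hα : -(ᾱ * θ) = ᾱ * (2 : ℕ) - (2 : ℕ) := by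
      rw [hᾱ]
      push_cast
      field_simp
      ring
    rw [hα, Real.rpow_sub ht, Real.rpow_mul_natCast ht.le, Real.rpow_natCast]
  have hmθ : m x t ^ θ
      = t ^ (-(ᾱ * θ)) * (R - (ᾱ * (1 - ᾱ) / 2) * (x / t ^ ᾱ) ^ 2) := by
    rw [hm, max_eq_left hpos.le, Real.mul_rpow (Real.rpow_nonneg ht.le _)
      (Real.rpow_nonneg hpos.le _), ← Real.rpow_mul ht.le, ← Real.rpow_mul hpos.le,
      one_div_mul_cancel hθ.ne', Real.rpow_one, neg_mul]
  have hb : t ^ ᾱ ≠ 0 := (Real.rpow_pos_of_pos ht _).ne'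
  rw [hx, ht', hmθ, hexp]
  field_simp
  ring
end

section
/- Let θ > 0, ᾱ = 2/(2+θ), R > 0, and let m be the self-similar density m(x,t) = t^{−ᾱ}·( R − (ᾱ(1−ᾱ)/2)·(x/t^ᾱ)² )₊^{1/θ}. Then m is a distributional solution of the continuity equation with drift velocity ᾱ·x/t: for every C^∞ compactly supported function φ : ℝ × (0,∞) → ℝ, ∫_0^∞ ∫_ℝ ( ∂_t φ(x,t) + ᾱ·(x/t)·∂_x φ(x,t) )·m(x,t) dx dt = 0. -/
open Real MeasureTheory

/-- A compact subset of the open upper half plane stays away from the boundary. -/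
lemma exists_pos_lt_snd_of_isCompact {K : Set (ℝ × ℝ)} (hK : IsCompact K)
    (h : K ⊆ {p : ℝ × ℝ | 0 < p.2}) : ∃ a : ℝ, 0 < a ∧ ∀ p ∈ K, a < p.2 := by
  rcases K.eq_empty_or_nonempty with rfl | hne
  · exact ⟨1, one_pos, by simp⟩
  · obtain ⟨p, hp, hmin⟩ := hK.exists_isMinOn hne continuous_snd.continuousOn
    have hp0 : 0 < p.2 := h hp
    refine ⟨p.2 / 2, half_pos hp0, fun q hq => ?_⟩
    have : p.2 ≤ q.2 := hmin hq
    linarith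

/-- Partial derivatives of a differentiable function on the plane in terms of `fderiv`. -/
lemma deriv_snd_eq_fderiv {φ : ℝ × ℝ → ℝ} (hφ : Differentiable ℝ φ) (x t : ℝ) :
    deriv (fun s => φ (x, s)) t = fderiv ℝ φ (x, t) (0, 1) :=
  ((hφ (x, t)).hasFDerivAt.comp_hasDerivAt t
    ((hasDerivAt_const t x).prodMk (hasDerivAt_id t))).deriv

lemma deriv_fst_eq_fderiv {φ : ℝ × ℝ → ℝ} (hφ : Differentiable ℝ φ) (x t : ℝ) :
    deriv (fun y => φ (y, t)) x = fderiv ℝ φ (x, t) (1, 0) :=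
  ((hφ (x, t)).hasFDerivAt.comp_hasDerivAt x
    ((hasDerivAt_id x).prodMk (hasDerivAt_const x t))).deriv

/-- The self-similar change of variables, with time truncated from below at `a`. -/
noncomputable def similarityMap (α a : ℝ) (p : ℝ × ℝ) : ℝ × ℝ :=
  ((max p.1 a) ^ α * p.2, p.1)

/-- The time derivative of `φ ∘ similarityMap α a` for times larger than `a`. -/
noncomputable def similarityDeriv (φ : ℝ × ℝ → ℝ) (α a : ℝ) (p : ℝ × ℝ) : ℝ :=
  fderiv ℝ φ (similarityMap α a p) (0, 1) +
    α * (max p.1 a) ^ (α - 1) * p.2 * fderiv ℝ φ (similarityMap α a p) (1, 0)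

lemma continuous_max_rpow {a : ℝ} (ha : 0 < a) (r : ℝ) :
    Continuous fun p : ℝ × ℝ => (max p.1 a) ^ r :=
  (continuous_fst.max continuous_const).rpow_const
    fun _ => Or.inl (lt_max_of_lt_right ha).ne'

lemma continuous_similarityMap (α : ℝ) {a : ℝ} (ha : 0 < a) :
    Continuous (similarityMap α a) :=
  ((continuous_max_rpow ha α).mul continuous_snd).prodMk continuous_fst

lemma continuous_similarityDeriv {φ : ℝ × ℝ → ℝ} (hφ : ContDiff ℝ 1 φ) (α : ℝ) {a : ℝ}
    (ha : 0 < a) : Continuous (similarityDeriv φ α a) := by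
  have h : Continuous fun p => fderiv ℝ φ (similarityMap α a p) :=
    (hφ.continuous_fderiv one_ne_zero).comp (continuous_similarityMap α ha)
  exact (h.clm_apply continuous_const).add
    (((continuous_const.mul (continuous_max_rpow ha _)).mul continuous_snd).mul
      (h.clm_apply continuous_const))

lemma similarityDeriv_eq_zero {φ : ℝ × ℝ → ℝ} {α a : ℝ} {p : ℝ × ℝ}
    (hp : similarityMap α a p ∉ tsupport φ) : similarityDeriv φ α a p = 0 := by
  simp [similarityDeriv, fderiv_of_notMem_tsupport ℝ hp]

/-- The truncated similarity map is a homeomorphism of the plane, hence proper. -/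
lemma isCompact_preimage_similarityMap (α : ℝ) {a : ℝ} (ha : 0 < a) {K : Set (ℝ × ℝ)}
    (hK : IsCompact K) : IsCompact (similarityMap α a ⁻¹' K) := by
  have hc : Continuous fun q : ℝ × ℝ => (q.2, (max q.2 a) ^ (-α) * q.1) :=
    continuous_snd.prodMk
      (((continuous_max_rpow ha (-α)).comp continuous_swap).mul continuous_fst)
  refine (hK.image hc).of_isClosed_subset
    (hK.isClosed.preimage (continuous_similarityMap α ha)) fun p hp => ⟨_, hp, ?_⟩
  have h0 : 0 < max p.1 a := lt_max_of_lt_right ha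
  ext
  · rfl
  · change (max p.1 a) ^ (-α) * ((max p.1 a) ^ α * p.2) = p.2
    rw [← mul_assoc, ← rpow_add h0]
    simp

lemma hasDerivAt_comp_similarityMap {φ : ℝ × ℝ → ℝ} (hφ : Differentiable ℝ φ) (α : ℝ)
    {a : ℝ} (ha : 0 < a) (hsupp : ∀ p ∈ tsupport φ, a < p.2) (y t : ℝ) :
    HasDerivAt (fun s => φ (similarityMap α a (s, y))) (similarityDeriv φ α a (t, y)) t := by
  rcases le_or_gt t a with hta | hta
  · have hp : similarityMap α a (t, y) ∉ tsupport φ := fun h => (hsupp _ h).not_ge hta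
    rw [similarityDeriv_eq_zero hp]
    have hc : Continuous fun s => similarityMap α a (s, y) :=
      (continuous_similarityMap α ha).comp (by fun_prop)
    exact (hasDerivAt_const t (0 : ℝ)).congr_of_eventuallyEq
      (hc.continuousAt.eventually (notMem_tsupport_iff_eventuallyEq.mp hp))
  · have ht : 0 < t := ha.trans hta
    have h1 : HasDerivAt (fun s : ℝ => (s ^ α * y, s)) (α * t ^ (α - 1) * y, 1) t :=
      ((hasDerivAt_rpow_const (Or.inl ht.ne')).mul_const y).prodMk (hasDerivAt_id t)
    have h2 := HasFDerivAt.comp_hasDerivAt (f := fun s : ℝ => (s ^ α * y, s)) t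
      (hφ (t ^ α * y, t)).hasFDerivAt h1
    have h3 : (fun s => φ (similarityMap α a (s, y))) =ᶠ[nhds t]
        φ ∘ fun s : ℝ => (s ^ α * y, s) := by
      filter_upwards [lt_mem_nhds hta] with s hs
      simp [similarityMap, max_eq_left hs.le]
    refine (h2.congr_of_eventuallyEq h3).congr_deriv ?_
    have h4 : ((α * t ^ (α - 1) * y, 1) : ℝ × ℝ)
        = (0, 1) + (α * t ^ (α - 1) * y) • (1, 0) := by simp
    rw [h4, map_add, map_smul]
    simp [similarityDeriv, similarityMap, max_eq_left hta.le]

/-- The drift `α x / t` transports any continuous self-similar profile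
`t ^ (-α) * G (x / t ^ α)`. -/
lemma integral_selfSimilar_eq_zero (α : ℝ) {G : ℝ → ℝ} (hG : Continuous G)
    {φ : ℝ × ℝ → ℝ} (hφ : ContDiff ℝ 1 φ) (hφc : HasCompactSupport φ)
    (hφsupp : tsupport φ ⊆ {p : ℝ × ℝ | 0 < p.2}) :
    (∫ t in Set.Ioi (0 : ℝ), ∫ x : ℝ,
      (deriv (fun s => φ (x, s)) t + α * (x / t) * deriv (fun y => φ (y, t)) x)
        * (t ^ (-α) * G (x / t ^ α))) = 0 := by
  obtain ⟨a, ha, hsupp⟩ := exists_pos_lt_snd_of_isCompact hφc hφsupp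
  have hd : Differentiable ℝ φ := hφ.differentiable one_ne_zero
  have hout : ∀ x t : ℝ, t ≤ a → (x, t) ∉ tsupport φ :=
    fun x t ht h => (hsupp _ h).not_ge ht
  have hchange : ∀ t : ℝ, (∫ x : ℝ,
      (deriv (fun s => φ (x, s)) t + α * (x / t) * deriv (fun y => φ (y, t)) x)
        * (t ^ (-α) * G (x / t ^ α))) = ∫ y : ℝ, similarityDeriv φ α a (t, y) * G y := by
    intro t
    simp only [deriv_snd_eq_fderiv hd, deriv_fst_eq_fderiv hd]
    rcases le_or_gt t a with hta | hta
    · have h1 : ∀ x, fderiv ℝ φ (x, t) = 0 := fun x =>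
        fderiv_of_notMem_tsupport ℝ (hout x t hta)
      have h2 : ∀ y, similarityDeriv φ α a (t, y) = 0 := fun y =>
        similarityDeriv_eq_zero (hout _ t hta)
      simp [h1, h2]
    · have ht : 0 < t := ha.trans hta
      have hc : 0 < t ^ α := rpow_pos_of_pos ht α
      have hsub := Measure.integral_comp_mul_left (fun x : ℝ =>
        (fderiv ℝ φ (x, t) (0, 1) + α * (x / t) * fderiv ℝ φ (x, t) (1, 0))
          * G (x / t ^ α)) (t ^ α)
      rw [abs_of_pos (inv_pos.mpr hc), smul_eq_mul, ← rpow_neg ht.le,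
        ← integral_const_mul] at hsub
      calc _ = _ := integral_congr_ae (.of_forall fun x => by ring)
        _ = _ := hsub.symm
        _ = _ := integral_congr_ae (.of_forall fun y => by
          simp only [similarityDeriv, similarityMap, max_eq_left hta.le,
            mul_div_cancel_left₀ y hc.ne', rpow_sub_one ht.ne']
          ring)
  simp only [hchange]
  have hcont : Continuous fun p : ℝ × ℝ => similarityDeriv φ α a p * G p.2 :=
    (continuous_similarityDeriv hφ α ha).mul (hG.comp continuous_snd)
  have hcomp : HasCompactSupport fun p : ℝ × ℝ => similarityDeriv φ α a p * G p.2 :=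
    .intro (isCompact_preimage_similarityMap α ha hφc) fun p hp => by
      simp [similarityDeriv_eq_zero (show similarityMap α a p ∉ tsupport φ from hp)]
  have hfull : ∀ t ∉ Set.Ioi (0 : ℝ), (∫ y : ℝ, similarityDeriv φ α a (t, y) * G y) = 0 := by
    intro t ht
    have hta : t ≤ a := (not_lt.mp ht).trans ha.le
    simp [fun y => similarityDeriv_eq_zero (p := (t, y)) (α := α) (a := a) (hout _ t hta)]
  rw [setIntegral_eq_integral_of_forall_compl_eq_zero hfull,
    integral_integral_swap (hcont.integrable_of_hasCompactSupport hcomp)]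
  refine integral_eq_zero_of_ae (.of_forall fun y => ?_)
  have hslice : Continuous fun t : ℝ => (t, y) := by fun_prop
  have hK : IsCompact ((fun t : ℝ => (t, y)) ⁻¹' (similarityMap α a ⁻¹' tsupport φ)) :=
    (Topology.IsClosedEmbedding.of_continuous_injective_isClosedMap hslice
      (fun _ _ h => congrArg Prod.fst h) (isClosedMap_prodMk_right y)).isCompact_preimage
      (isCompact_preimage_similarityMap α ha hφc)
  have hD : Integrable fun t => similarityDeriv φ α a (t, y) :=
    ((continuous_similarityDeriv hφ α ha).comp hslice).integrable_of_hasCompactSupport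
      (.intro hK fun t ht => similarityDeriv_eq_zero ht)
  have hψ : Integrable fun t => φ (similarityMap α a (t, y)) :=
    (hφ.continuous.comp ((continuous_similarityMap α ha).comp
      hslice)).integrable_of_hasCompactSupport
      (.intro hK fun t ht => image_eq_zero_of_notMem_tsupport (f := φ) ht)
  simp only [integral_mul_const, Pi.zero_apply]
  rw [integral_eq_zero_of_hasDerivAt_of_integrable
    (hasDerivAt_comp_similarityMap hd α ha hsupp y) hD hψ, zero_mul]

/-- The self-similar density `m(x,t) = t^{-ᾱ} (R - (ᾱ(1-ᾱ)/2)(x/t^ᾱ)²)₊^{1/θ}` with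
`ᾱ = 2/(2+θ)` is a distributional solution of the continuity equation with drift velocity
`ᾱ x / t`: for every smooth compactly supported test function `φ` supported in
`ℝ × (0,∞)`, `∫₀^∞ ∫_ℝ (∂ₜφ + ᾱ (x/t) ∂ₓφ) m dx dt = 0`. -/
theorem stmt18
    (θ ᾱ R : ℝ) (hθ : 0 < θ) (hᾱ : ᾱ = 2 / (2 + θ)) (hR : 0 < R)
    (m : ℝ → ℝ → ℝ)
    (hm : ∀ x t : ℝ, m x t =
      t ^ (-ᾱ) * (max (R - (ᾱ * (1 - ᾱ) / 2) * (x / t ^ ᾱ)^2) 0) ^ (1/θ))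
    (φ : ℝ × ℝ → ℝ)
    (hφ : ContDiff ℝ (⊤ : ℕ∞) φ)
    (hφc : HasCompactSupport φ)
    (hφsupp : tsupport φ ⊆ {p : ℝ × ℝ | 0 < p.2}) :
    (∫ t in Set.Ioi (0:ℝ), ∫ x : ℝ,
      (deriv (fun s => φ (x, s)) t + ᾱ * (x / t) * deriv (fun y => φ (y, t)) x)
        * m x t) = 0 := by
  have hG : Continuous fun y : ℝ =>
      (max (R - (ᾱ * (1 - ᾱ) / 2) * y ^ 2) 0) ^ (1 / θ) :=
    Continuous.rpow_const (by fun_prop) fun _ => Or.inr (one_div_pos.mpr hθ).le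
  simp only [hm]
  exact integral_selfSimilar_eq_zero ᾱ hG (hφ.of_le (by simp)) hφc hφsupp
end

section
/- Let ᾱ ∈ (0,1), R > 0, and set C_R = √(2R/(ᾱ(1−ᾱ))). Let t > 0 and x ∈ ℝ satisfy Δ := |x| − C_R·t^ᾱ > 0. Then: (i) there exists a unique S ∈ (0,t) such that ᾱ·C_R·t = |x|·S^{1−ᾱ} − (1−ᾱ)·C_R·S; (ii) this S satisfies S ≥ c₀·( t/(|x|+Δ) )^{1/(1−ᾱ)} with c₀ = ( 2Rᾱ/(1−ᾱ) )^{1/(2(1−ᾱ))}; and (iii) |t − S| ≤ C₀·t^{1−ᾱ/2}·Δ^{1/2} with C₀ = ( 2/(R·ᾱ·(1−ᾱ)) )^{1/4}. -/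
open Real

/-- A quantitative weighted AM-GM inequality. -/
lemma quadratic_le_rpow_gap {a s : ℝ} (ha : a ∈ Set.Ioo (0:ℝ) 1) (hs : 0 < s) (hs1 : s ≤ 1) :
    a * (1 - a) / 2 * (1 - s) ^ 2 ≤ a * s ^ (a - 1) + (1 - a) * s ^ a - 1 := by
  obtain ⟨ha0, ha1⟩ := ha
  have hder : ∀ u : ℝ, 0 < u → HasDerivAt
      (fun u : ℝ => a * u ^ (a - 1) + (1 - a) * u ^ a - 1 - a * (1 - a) / 2 * (1 - u) ^ 2)
      (a * (1 - a) * (1 - u) * (1 - u ^ (a - 2))) u := by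
    intro u hu
    have h1 := (Real.hasDerivAt_rpow_const (p := a - 1) (Or.inl hu.ne')).const_mul a
    have h2 := (Real.hasDerivAt_rpow_const (p := a) (Or.inl hu.ne')).const_mul (1 - a)
    have h3 := ((((hasDerivAt_id u).const_sub 1).pow 2).const_mul (a * (1 - a) / 2))
    refine (((h1.add h2).sub_const 1).sub h3).congr_deriv ?_
    have e1 : u ^ (a - 1) = u ^ (a - 2) * u := by
      rw [← Real.rpow_add_one hu.ne']; congr 1; ring
    have e2 : u ^ (a - 1 - 1) = u ^ (a - 2) := by congr 1; ring
    rw [e2, e1]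
    simp only [id]
    push_cast
    ring
  have hanti : AntitoneOn
      (fun u : ℝ => a * u ^ (a - 1) + (1 - a) * u ^ a - 1 - a * (1 - a) / 2 * (1 - u) ^ 2)
      (Set.Icc s 1) := by
    apply antitoneOn_of_deriv_nonpos (convex_Icc s 1)
    · intro u hu
      exact (hder u (hs.trans_le hu.1)).continuousAt.continuousWithinAt
    · intro u hu
      rw [interior_Icc] at hu
      exact (hder u (hs.trans hu.1)).differentiableAt.differentiableWithinAt
    · intro u hu
      rw [interior_Icc] at hu
      have hu0 : 0 < u := hs.trans hu.1
      rw [(hder u hu0).deriv]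
      have h1 : 1 ≤ u ^ (a - 2) :=
        Real.one_le_rpow_of_pos_of_le_one_of_nonpos hu0 hu.2.le (by linarith)
      apply mul_nonpos_of_nonneg_of_nonpos
      · exact mul_nonneg (mul_nonneg ha0.le (by linarith)) (by linarith [hu.2])
      · linarith
  have h := hanti (Set.left_mem_Icc.2 hs1) (Set.right_mem_Icc.2 hs1) hs1
  simp only [Real.one_rpow] at h
  linarith

/-- The map of the implicit equation is strictly increasing up to time `t`. -/
lemma strictMonoOn_rpow_sub_linear {a C X t : ℝ} (ha : a ∈ Set.Ioo (0:ℝ) 1) (hC : 0 ≤ C)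
    (hX : C * t ^ a < X) :
    StrictMonoOn (fun S : ℝ => X * S ^ (1 - a) - (1 - a) * C * S) (Set.Icc 0 t) := by
  obtain ⟨ha0, ha1⟩ := ha
  apply strictMonoOn_of_deriv_pos (convex_Icc 0 t)
  · exact (((Real.continuous_rpow_const (by linarith)).const_mul X).sub
      (continuous_const.mul continuous_id)).continuousOn
  · intro u hu
    rw [interior_Icc] at hu
    have hu0 : 0 < u := hu.1
    have hd := ((Real.hasDerivAt_rpow_const (p := 1 - a) (Or.inl hu0.ne')).const_mul X).sub
      ((hasDerivAt_id u).const_mul ((1 - a) * C))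
    have hval : 0 < X * ((1 - a) * u ^ (1 - a - 1)) - (1 - a) * C * 1 := by
      have e : u ^ (1 - a - 1) * u ^ a = 1 := by
        rw [← Real.rpow_add hu0]; simp
      have hp : 0 < u ^ (1 - a - 1) := Real.rpow_pos_of_pos hu0 _
      have hle : C * u ^ a < X :=
        (mul_le_mul_of_nonneg_left (Real.rpow_le_rpow hu0.le hu.2.le ha0.le) hC).trans_lt hX
      have h1 := mul_pos (mul_pos (sub_pos.2 ha1) hp) (sub_pos.2 hle)
      have h2 : (1 - a) * u ^ (1 - a - 1) * (X - C * u ^ a)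
          = X * ((1 - a) * u ^ (1 - a - 1)) - (1 - a) * C * (u ^ (1 - a - 1) * u ^ a) := by ring
      rwa [h2, e] at h1
    have hd' := hd.deriv
    exact hval.trans_eq hd'.symm

/-- The implicit-equation lemma for the self-similar solution: if
`Δ = |x| - C_R t^ᾱ > 0` with `C_R = √(2R/(ᾱ(1-ᾱ)))`, then there is a unique `S ∈ (0,t)`
with `ᾱ C_R t = |x| S^{1-ᾱ} - (1-ᾱ) C_R S`, and it satisfies
`S ≥ c₀ (t/(|x|+Δ))^{1/(1-ᾱ)}` with `c₀ = (2Rᾱ/(1-ᾱ))^{1/(2(1-ᾱ))}`, and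
`|t - S| ≤ C₀ t^{1-ᾱ/2} Δ^{1/2}` with `C₀ = (2/(R ᾱ (1-ᾱ)))^{1/4}`. -/
theorem stmt19
    (ᾱ R : ℝ) (hᾱ : ᾱ ∈ Set.Ioo (0:ℝ) 1) (hR : 0 < R)
    (C_R : ℝ) (hCR : C_R = Real.sqrt (2 * R / (ᾱ * (1 - ᾱ))))
    (t x : ℝ) (ht : 0 < t)
    (hΔ : 0 < |x| - C_R * t ^ ᾱ) :
    ∃ S : ℝ,
      (S ∈ Set.Ioo 0 t ∧
        ᾱ * C_R * t = |x| * S ^ (1 - ᾱ) - (1 - ᾱ) * C_R * S) ∧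
      (∀ S' : ℝ, S' ∈ Set.Ioo 0 t →
        ᾱ * C_R * t = |x| * S' ^ (1 - ᾱ) - (1 - ᾱ) * C_R * S' → S' = S) ∧
      (2 * R * ᾱ / (1 - ᾱ)) ^ (1 / (2 * (1 - ᾱ)))
          * (t / (|x| + (|x| - C_R * t ^ ᾱ))) ^ (1 / (1 - ᾱ)) ≤ S ∧
      |t - S| ≤ (2 / (R * ᾱ * (1 - ᾱ))) ^ ((1:ℝ)/4)
          * t ^ (1 - ᾱ/2) * (|x| - C_R * t ^ ᾱ) ^ ((1:ℝ)/2) := by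
  have hmono := strictMonoOn_rpow_sub_linear hᾱ (hCR ▸ Real.sqrt_nonneg _) (sub_pos.1 hΔ)
  obtain ⟨ha0, ha1⟩ := hᾱ
  have hb : 0 < 1 - ᾱ := sub_pos.2 ha1
  have hC : 0 < C_R := by rw [hCR]; positivity
  have hC2 : C_R ^ 2 = 2 * R / (ᾱ * (1 - ᾱ)) := by
    rw [hCR]; exact Real.sq_sqrt (by positivity)
  have hta : t ^ ᾱ * t ^ (1 - ᾱ) = t := by rw [← Real.rpow_add ht]; simp
  have htb : 0 < t ^ (1 - ᾱ) := Real.rpow_pos_of_pos ht _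
  have hcont : ContinuousOn (fun S : ℝ => |x| * S ^ (1 - ᾱ) - (1 - ᾱ) * C_R * S)
      (Set.Icc 0 t) :=
    (((Real.continuous_rpow_const hb.le).const_mul |x|).sub
      (continuous_const.mul continuous_id)).continuousOn
  obtain ⟨S, hS, hSeq⟩ : ᾱ * C_R * t ∈
      (fun S : ℝ => |x| * S ^ (1 - ᾱ) - (1 - ᾱ) * C_R * S) '' Set.Ioo 0 t := by
    apply intermediate_value_Ioo ht.le hcont
    constructor
    · simp only [Real.zero_rpow hb.ne', mul_zero, sub_zero]
      positivity
    · have h := mul_pos hΔ htb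
      have e : (|x| - C_R * t ^ ᾱ) * t ^ (1 - ᾱ) = |x| * t ^ (1 - ᾱ) - C_R * t := by
        rw [sub_mul, mul_assoc, hta]
      linarith
  simp only at hSeq
  obtain ⟨hS0, hSt⟩ := hS
  have hSb : 0 < S ^ (1 - ᾱ) := Real.rpow_pos_of_pos hS0 _
  refine ⟨S, ⟨⟨hS0, hSt⟩, hSeq.symm⟩, ?_, ?_, ?_⟩
  · intro S' hS' h'
    exact hmono.injOn ⟨hS'.1.le, hS'.2.le⟩ ⟨hS0.le, hSt.le⟩ (h'.symm.trans hSeq.symm)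
  · have hD : 0 < |x| + (|x| - C_R * t ^ ᾱ) := by positivity
    have ec : 2 * R * ᾱ / (1 - ᾱ) = (ᾱ * C_R) ^ (2:ℝ) := by
      rw [Real.rpow_two, mul_pow, hC2]; field_simp
    have ee : (2:ℝ) * (1 / (2 * (1 - ᾱ))) = 1 / (1 - ᾱ) := by field_simp
    rw [ec, ← Real.rpow_mul (by positivity), ee, ← Real.mul_rpow (by positivity) (by positivity),
      one_div]
    apply (Real.rpow_inv_le_iff_of_pos (by positivity) hS0.le hb).2
    rw [← mul_div_assoc, div_le_iff₀ hD]
    nlinarith [mul_pos hΔ hSb, mul_pos (mul_pos hb hC) hS0]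
  · have hs : 0 < S / t := div_pos hS0 ht
    have hgap := quadratic_le_rpow_gap ⟨ha0, ha1⟩ hs ((div_le_one ht).2 hSt.le)
    have hta' : 0 < t ^ ᾱ := Real.rpow_pos_of_pos ht _
    have eΔ : C_R * t ^ ᾱ * (ᾱ * (S / t) ^ (ᾱ - 1) + (1 - ᾱ) * (S / t) ^ ᾱ - 1)
        = |x| - C_R * t ^ ᾱ := by
      have hSa : S ^ ᾱ * S ^ (1 - ᾱ) = S := by rw [← Real.rpow_add hS0]; simp
      have hSi : S ^ (ᾱ - 1) * S ^ (1 - ᾱ) = 1 := by rw [← Real.rpow_add hS0]; simp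
      have hti : t ^ (ᾱ - 1) * t = t ^ ᾱ := by
        rw [← Real.rpow_add_one ht.ne']; congr 1; ring
      have hti0 : 0 < t ^ (ᾱ - 1) := Real.rpow_pos_of_pos ht _
      rw [Real.div_rpow hS0.le ht.le, Real.div_rpow hS0.le ht.le]
      have h1 : t ^ ᾱ * (S ^ (ᾱ - 1) / t ^ (ᾱ - 1)) = t * S ^ (ᾱ - 1) := by
        rw [← hti]; field_simp
      have h2 : t ^ ᾱ * (S ^ ᾱ / t ^ ᾱ) = S ^ ᾱ := by field_simp
      have h3 : C_R * (ᾱ * (t * S ^ (ᾱ - 1)) + (1 - ᾱ) * S ^ ᾱ) = |x| := by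
        apply mul_right_cancel₀ hSb.ne'
        linear_combination hSeq.symm + C_R * ᾱ * t * hSi + C_R * (1 - ᾱ) * hSa
      linear_combination h3 + C_R * ᾱ * h1 + C_R * (1 - ᾱ) * h2
    set Δ := |x| - C_R * t ^ ᾱ with hΔdef
    have ht2 : t ^ (2 - ᾱ) * t ^ ᾱ = t ^ 2 := by
      rw [← Real.rpow_add ht, ← Real.rpow_two]; congr 1; ring
    have hkey : ᾱ * (1 - ᾱ) / 2 * C_R * (t - S) ^ 2 ≤ t ^ (2 - ᾱ) * Δ := by
      have h := mul_le_mul_of_nonneg_left hgap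
        (show 0 ≤ t ^ (2 - ᾱ) * (C_R * t ^ ᾱ) by positivity)
      rw [mul_assoc _ (C_R * t ^ ᾱ) (_ - 1), eΔ] at h
      refine le_of_eq_of_le ?_ h
      have e : t - S = t * (1 - S / t) := by field_simp
      rw [e, mul_pow, ← ht2]; ring
    have hK0 : 0 ≤ 2 / (R * ᾱ * (1 - ᾱ)) := by positivity
    have hK : ((2 / (R * ᾱ * (1 - ᾱ))) ^ ((1:ℝ)/4)) ^ 2 = 2 / (ᾱ * (1 - ᾱ) * C_R) := by
      rw [← Real.rpow_natCast, ← Real.rpow_mul hK0,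
        show (1:ℝ) / 4 * (2:ℕ) = 1 / 2 by norm_num, ← Real.sqrt_eq_rpow,
        Real.sqrt_eq_iff_mul_self_eq hK0 (by positivity), ← pow_two, div_pow, mul_pow, hC2]
      field_simp
    rw [abs_of_pos (sub_pos.2 hSt)]
    have hT : (t ^ (1 - ᾱ / 2)) ^ 2 = t ^ (2 - ᾱ) := by
      rw [← Real.rpow_natCast, ← Real.rpow_mul ht.le]; congr 1; push_cast; ring
    have hD : (Δ ^ ((1:ℝ)/2)) ^ 2 = Δ := by
      rw [← Real.sqrt_eq_rpow, Real.sq_sqrt hΔ.le]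
    apply (sq_le_sq₀ (sub_pos.2 hSt).le (by positivity)).1
    rw [mul_pow, mul_pow, hK, hT, hD, mul_assoc, div_mul_eq_mul_div, le_div_iff₀ (by positivity)]
    linarith
end
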